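/- arXiv:2301.05678 — 4 statements merged into one kernel-verified Lean document; each statement's English description precedes it below -/
import Mathlib

section
/- Let t ≥ 2 and let G be a graph on n vertices. For each t-clique T of G define α_G(T) to be the largest k such that T is contained in the vertex set of a subgraph of G isomorphic to K_k, and define the weight w_G(T) = α_G(T)^t / C(α_G(T), t). Then α_G(T) ≥ t for every t-clique T (so w_G(T) is well-defined), and the sum of w_G(T) over all t-cliques T of G is at most n^t. -/
/-- elementary symmetric sum -/
noncomputable def ESym {V : Type*} [DecidableEq V] (x : V → ℝ) (k : ℕ) (S : Finset V) : ℝ :=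
  ∑ T ∈ S.powersetCard k, ∏ i ∈ T, x i

lemma ESym_nonneg {V : Type*} [DecidableEq V] (x : V → ℝ) (hx : ∀ i, 0 ≤ x i) (k : ℕ)
    (S : Finset V) : 0 ≤ ESym x k S :=
  Finset.sum_nonneg fun _ _ => Finset.prod_nonneg fun i _ => hx i

lemma ESym_insert {V : Type*} [DecidableEq V] (x : V → ℝ) (k : ℕ) (S : Finset V) (a : V)
    (ha : a ∉ S) : ESym x (k + 1) (insert a S) = ESym x (k + 1) S + x a * ESym x k S := by
  unfold ESym
  rw [Finset.powersetCard_succ_insert ha, Finset.sum_union, Finset.sum_image, Finset.mul_sum]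
  · congr 1
    refine Finset.sum_congr rfl fun T hT => ?_
    rw [Finset.prod_insert]
    exact fun h => ha ((Finset.mem_powersetCard.1 hT).1 h)
  · intro T hT U hU h
    have h1 : a ∉ T := fun h => ha ((Finset.mem_powersetCard.1 hT).1 h)
    have h2 : a ∉ U := fun h => ha ((Finset.mem_powersetCard.1 hU).1 h)
    rw [← Finset.erase_insert h1, ← Finset.erase_insert h2]
    rw [h]
  · rw [Finset.disjoint_left]
    intro T hT hU
    obtain ⟨U, hU, rfl⟩ := Finset.mem_image.1 hU
    exact ha ((Finset.mem_powersetCard.1 hT).1 (Finset.mem_insert_self _ _))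

lemma ESym_erase {V : Type*} [DecidableEq V] (x : V → ℝ) (k : ℕ) (S : Finset V) (a : V)
    (ha : a ∈ S) :
    ESym x (k + 1) S = ESym x (k + 1) (S.erase a) + x a * ESym x k (S.erase a) := by
  rw [← ESym_insert x k _ a (Finset.notMem_erase a S), Finset.insert_erase ha]

lemma ESym_zero_of_lt {V : Type*} [DecidableEq V] (x : V → ℝ) (k : ℕ) (S : Finset V)
    (h : S.card < k) : ESym x k S = 0 := by
  unfold ESym
  rw [Finset.powersetCard_eq_empty.2 h, Finset.sum_empty]

lemma sum_ESym_erase {V : Type*} [DecidableEq V] (x : V → ℝ) (k : ℕ) (S : Finset V) :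
    ∑ i ∈ S, ESym x k (S.erase i) = ((S.card - k : ℕ) : ℝ) * ESym x k S := by
  unfold ESym
  rw [Finset.mul_sum, Finset.sum_comm' (t' := S.powersetCard k) (s' := fun T => S \ T)]
  · refine Finset.sum_congr rfl fun T hT => ?_
    obtain ⟨h1, h2⟩ := Finset.mem_powersetCard.1 hT
    rw [Finset.sum_const, Finset.card_sdiff_of_subset h1, h2, nsmul_eq_mul]
  · intro i T
    simp only [Finset.mem_powersetCard, Finset.mem_sdiff, Finset.subset_erase]
    tauto

lemma sum_mul_ESym_erase {V : Type*} [DecidableEq V] (x : V → ℝ) (k : ℕ) (S : Finset V) :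
    ∑ i ∈ S, x i * ESym x k (S.erase i) = (k + 1 : ℝ) * ESym x (k + 1) S := by
  have h1 : ∑ i ∈ S, ESym x (k + 1) S =
      ∑ i ∈ S, ESym x (k + 1) (S.erase i) + ∑ i ∈ S, x i * ESym x k (S.erase i) := by
    rw [← Finset.sum_add_distrib]
    exact Finset.sum_congr rfl fun i hi => ESym_erase x k S i hi
  rw [sum_ESym_erase, Finset.sum_const, nsmul_eq_mul] at h1
  by_cases h : k + 1 ≤ S.card
  · rw [Nat.cast_sub h] at h1
    push_cast at h1
    linarith
  · rw [ESym_zero_of_lt x (k + 1) S (by omega)] at h1 ⊢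
    linarith

lemma ESym_antivary {V : Type*} [DecidableEq V] (x : V → ℝ) (hx : ∀ i, 0 ≤ x i) (k : ℕ)
    (S : Finset V) : AntivaryOn x (fun i => ESym x k (S.erase i)) S := by
  intro i hi j hj hij
  by_contra! hlt
  have hne : i ≠ j := by rintro rfl; exact lt_irrefl _ hlt
  simp only at hij
  cases k with
  | zero => simp [ESym] at hij
  | succ k =>
    rw [ESym_erase x k (S.erase i) j (Finset.mem_erase.2 ⟨hne.symm, hj⟩),
      ESym_erase x k (S.erase j) i (Finset.mem_erase.2 ⟨hne, hi⟩),
      Finset.erase_right_comm] at hij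
    have := ESym_nonneg x hx k ((S.erase j).erase i)
    nlinarith

lemma maclaurin {V : Type*} [DecidableEq V] (x : V → ℝ) (hx : ∀ i, 0 ≤ x i) (k : ℕ)
    (S : Finset V) :
    ESym x k S * (S.card : ℝ) ^ k ≤ (S.card.choose k : ℝ) * (∑ i ∈ S, x i) ^ k := by
  induction k with
  | zero => simp [ESym]
  | succ k ih =>
    have h := (ESym_antivary x hx k S).card_mul_sum_le_sum_mul_sum
    rw [sum_mul_ESym_erase, sum_ESym_erase] at h
    have hc : (S.card.choose (k + 1) : ℝ) * (k + 1) = S.card.choose k * ((S.card - k : ℕ) : ℝ) := by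
      exact_mod_cast Nat.choose_succ_right_eq S.card k
    have he : 0 ≤ ∑ i ∈ S, x i := Finset.sum_nonneg fun i _ => hx i
    have hk : (0 : ℝ) < k + 1 := by positivity
    refine le_of_mul_le_mul_right ?_ hk
    calc ESym x (k + 1) S * (S.card : ℝ) ^ (k + 1) * (k + 1)
        = (S.card * ((k + 1) * ESym x (k + 1) S)) * (S.card : ℝ) ^ k := by ring
      _ ≤ ((∑ i ∈ S, x i) * (((S.card - k : ℕ) : ℝ) * ESym x k S)) * (S.card : ℝ) ^ k := by
          gcongr
      _ = (∑ i ∈ S, x i) * ((S.card - k : ℕ) : ℝ) * (ESym x k S * (S.card : ℝ) ^ k) := by ring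
      _ ≤ (∑ i ∈ S, x i) * ((S.card - k : ℕ) : ℝ) *
            ((S.card.choose k : ℝ) * (∑ i ∈ S, x i) ^ k) := by gcongr
      _ = (S.card.choose k * ((S.card - k : ℕ) : ℝ)) * (∑ i ∈ S, x i) ^ (k + 1) := by ring
      _ = _ := by rw [← hc]; ring

lemma weight_anti_aux (a b t : ℕ) (hab : a ≤ b) :
    b ^ t * a.choose t ≤ a ^ t * b.choose t := by
  induction t with
  | zero => simp
  | succ t ih =>
    have h1 := Nat.choose_succ_right_eq a t
    have h2 := Nat.choose_succ_right_eq b t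
    have h3 : b * (a - t) ≤ a * (b - t) := by
      rw [Nat.mul_sub, Nat.mul_sub, Nat.mul_comm b a]
      exact Nat.sub_le_sub_left (Nat.mul_le_mul_right t hab) _
    refine Nat.le_of_mul_le_mul_right ?_ (show 0 < t + 1 by omega)
    calc b ^ (t + 1) * a.choose (t + 1) * (t + 1)
        = b ^ (t + 1) * (a.choose (t + 1) * (t + 1)) := by ring
      _ = (b ^ t * a.choose t) * (b * (a - t)) := by rw [h1]; ring
      _ ≤ (a ^ t * b.choose t) * (a * (b - t)) := Nat.mul_le_mul ih h3
      _ = a ^ (t + 1) * (b.choose t * (b - t)) := by ring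
      _ = _ := by rw [← h2]; ring

lemma weight_anti (a b t : ℕ) (ha : t ≤ a) (hab : a ≤ b) :
    (b : ℝ) ^ t / (b.choose t : ℝ) ≤ (a : ℝ) ^ t / (a.choose t : ℝ) := by
  have h1 : (0 : ℝ) < a.choose t := by exact_mod_cast Nat.choose_pos ha
  have h2 : (0 : ℝ) < b.choose t := by exact_mod_cast Nat.choose_pos (ha.trans hab)
  rw [div_le_div_iff₀ h2 h1]
  exact_mod_cast weight_anti_aux a b t hab

/-- On a family with no member containing both `u` and `v`, the polynomial is affine in
the coordinates `u`, `v`. -/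
lemma affine_pair {V : Type*} [DecidableEq V] (K : Finset (Finset V)) (w : Finset V → ℝ)
    (x : V → ℝ) (u v : V) (hK : ∀ T ∈ K, ¬ (u ∈ T ∧ v ∈ T)) :
    ∃ A B C : ℝ, ∀ y : V → ℝ, (∀ i, i ≠ u → i ≠ v → y i = x i) →
      ∑ T ∈ K, w T * ∏ i ∈ T, y i = A * y u + B * y v + C := by
  refine ⟨∑ T ∈ K, if u ∈ T then w T * ∏ i ∈ T.erase u, x i else 0,
    ∑ T ∈ K, if v ∈ T then w T * ∏ i ∈ T.erase v, x i else 0,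
    ∑ T ∈ K, if u ∈ T ∨ v ∈ T then 0 else w T * ∏ i ∈ T, x i, fun y hy => ?_⟩
  rw [Finset.sum_mul, Finset.sum_mul, ← Finset.sum_add_distrib, ← Finset.sum_add_distrib]
  refine Finset.sum_congr rfl fun T hT => ?_
  have hT' := hK T hT
  by_cases hu : u ∈ T
  · have hv : v ∉ T := fun h => hT' ⟨hu, h⟩
    simp only [hu, hv, if_true, if_false, true_or]
    rw [← Finset.mul_prod_erase T y hu, Finset.prod_congr rfl (g := x)]
    · ring
    · intro i hi
      have := Finset.mem_erase.1 hi
      exact hy i this.1 (fun h => hv (h ▸ this.2))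
  · by_cases hv : v ∈ T
    · simp only [hu, hv, if_true, if_false, or_true]
      rw [← Finset.mul_prod_erase T y hv, Finset.prod_congr rfl (g := x)]
      · ring
      · intro i hi
        have := Finset.mem_erase.1 hi
        exact hy i (fun h => hu (h ▸ this.2)) this.1
    · simp only [hu, hv, if_false, or_self]
      rw [Finset.prod_congr rfl (g := x)]
      · ring
      · intro i hi
        exact hy i (fun h => hu (h ▸ hi)) (fun h => hv (h ▸ hi))

/-- shifting the mass of `q` to `p` -/
noncomputable def shiftMass {V : Type*} [DecidableEq V] (x : V → ℝ) (p q : V) : V → ℝ :=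
  fun i => if i = q then 0 else if i = p then x p + x q else x i

lemma sum_shiftMass {V : Type*} [Fintype V] [DecidableEq V] (x : V → ℝ) (p q : V) (h : p ≠ q) :
    ∑ i, shiftMass x p q i = ∑ i, x i := by
  have hp : p ∈ (Finset.univ : Finset V).erase q := by simp [h]
  rw [← Finset.add_sum_erase _ _ (Finset.mem_univ q), ← Finset.add_sum_erase _ _ hp,
    ← Finset.add_sum_erase _ x (Finset.mem_univ q), ← Finset.add_sum_erase _ x hp,
    Finset.sum_congr rfl (g := x)]
  · simp [shiftMass, h]; ring
  · intro i hi
    simp only [Finset.mem_erase] at hi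
    simp [shiftMass, hi.1, hi.2.1]

lemma lagrangian {V : Type*} [Fintype V] [DecidableEq V]
    (G : SimpleGraph V) [DecidableRel G.Adj] (t : ℕ) (w : Finset V → ℝ)
    (hw : ∀ S T : Finset V, G.IsClique S → T ⊆ S → T.card = t →
      w T ≤ (S.card : ℝ) ^ t / (S.card.choose t : ℝ)) (m : ℕ) :
    ∀ x : V → ℝ, (∀ i, 0 ≤ x i) → (Finset.univ.filter fun i => x i ≠ 0).card ≤ m →
      ∑ T ∈ G.cliqueFinset t, w T * ∏ i ∈ T, x i ≤ (∑ i, x i) ^ t := by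
  induction m using Nat.strong_induction_on with
  | _ m ih =>
  intro x hx hm
  set S : Finset V := Finset.univ.filter fun i => x i ≠ 0 with hS
  have hmemS : ∀ i, i ∈ S ↔ x i ≠ 0 := fun i => by simp [hS]
  by_cases hcl : G.IsClique (S : Set V)
  · have hsum : ∑ i ∈ S, x i = ∑ i, x i := by
      refine Finset.sum_subset (Finset.subset_univ _) fun i _ hi => ?_
      by_contra h
      exact hi ((hmemS i).2 h)
    have h1 : ∑ T ∈ G.cliqueFinset t, w T * ∏ i ∈ T, x i
        = ∑ T ∈ S.powersetCard t, w T * ∏ i ∈ T, x i := by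
      symm
      refine Finset.sum_subset ?_ ?_
      · intro T hT
        obtain ⟨hTS, hTc⟩ := Finset.mem_powersetCard.1 hT
        rw [SimpleGraph.mem_cliqueFinset_iff, SimpleGraph.isNClique_iff]
        exact ⟨hcl.subset (by exact_mod_cast hTS), hTc⟩
      · intro T hT hT2
        rw [SimpleGraph.mem_cliqueFinset_iff, SimpleGraph.isNClique_iff] at hT
        have : ¬ T ⊆ S := fun h => hT2 (Finset.mem_powersetCard.2 ⟨h, hT.2⟩)
        obtain ⟨i, hi, hiS⟩ := Finset.not_subset.1 this
        have hz : x i = 0 := by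
          by_contra h
          exact hiS ((hmemS i).2 h)
        rw [Finset.prod_eq_zero hi hz, mul_zero]
    rw [h1]
    have h2 : ∑ T ∈ S.powersetCard t, w T * ∏ i ∈ T, x i
        ≤ (S.card : ℝ) ^ t / (S.card.choose t : ℝ) * ESym x t S := by
      unfold ESym
      rw [Finset.mul_sum]
      refine Finset.sum_le_sum fun T hT => ?_
      obtain ⟨hTS, hTc⟩ := Finset.mem_powersetCard.1 hT
      exact mul_le_mul_of_nonneg_right (hw S T hcl hTS hTc)
        (Finset.prod_nonneg fun i _ => hx i)
    refine h2.trans ?_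
    have h3 := maclaurin x hx t S
    rw [hsum] at h3
    have h4 : 0 ≤ (∑ i, x i) ^ t := pow_nonneg (Finset.sum_nonneg fun i _ => hx i) _
    by_cases hts : t ≤ S.card
    · have hc : (0 : ℝ) < S.card.choose t := by exact_mod_cast Nat.choose_pos hts
      rw [div_mul_eq_mul_div, div_le_iff₀ hc]
      linarith
    · rw [ESym_zero_of_lt x t S (by omega), mul_zero]
      exact h4
  · have key : ∀ p q : V, p ≠ q → x q ≠ 0 → x p ≠ 0 →
        ∑ T ∈ G.cliqueFinset t, w T * ∏ i ∈ T, shiftMass x p q i ≤ (∑ i, x i) ^ t := by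
      intro p q hpq hq hp
      rw [← sum_shiftMass x p q hpq]
      have hlt : (Finset.univ.filter fun i => shiftMass x p q i ≠ 0).card < S.card := by
        refine Finset.card_lt_card ⟨?_, ?_⟩
        · intro i hi
          rw [hmemS]
          simp only [Finset.mem_filter, Finset.mem_univ, true_and, shiftMass] at hi
          by_cases h1 : i = q
          · simp [h1] at hi
          · by_cases h2 : i = p
            · rw [h2]; exact hp
            · simpa [h1, h2] using hi
        · intro h
          have := h ((hmemS q).2 hq)
          simp [shiftMass] at this
      refine ih _ (lt_of_lt_of_le hlt hm) _ ?_ le_rfl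
      intro i
      unfold shiftMass
      split_ifs
      · exact le_rfl
      · exact add_nonneg (hx p) (hx q)
      · exact hx i
    obtain ⟨u, huS, v, hvS, huv, hadj⟩ :
        ∃ u, u ∈ S ∧ ∃ v, v ∈ S ∧ u ≠ v ∧ ¬ G.Adj u v := by
      by_contra! hcon
      exact hcl fun u hu v hv h => hcon u hu v hv h
    have hu := (hmemS u).1 huS
    have hv := (hmemS v).1 hvS
    obtain ⟨A, B, C, hABC⟩ := affine_pair (G.cliqueFinset t) w x u v (by
      rintro T hT ⟨h1, h2⟩
      rw [SimpleGraph.mem_cliqueFinset_iff, SimpleGraph.isNClique_iff] at hT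
      exact hadj (hT.1 h1 h2 huv))
    have e0 := hABC x (fun _ _ _ => rfl)
    have e1 := hABC (shiftMass x u v) (fun i h1 h2 => by simp [shiftMass, h1, h2])
    have e2 := hABC (shiftMass x v u) (fun i h1 h2 => by simp [shiftMass, h1, h2])
    have k1 := key u v huv hv hu
    have k2 := key v u huv.symm hu hv
    rw [e1] at k1
    rw [e2] at k2
    rw [e0]
    simp only [shiftMass, if_true, huv, huv.symm, if_false] at k1 k2
    rcases le_total A B with h | h
    · have := mul_le_mul_of_nonneg_right h (hx u)
      linarith
    · have := mul_le_mul_of_nonneg_right h (hx v)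
      linarith

theorem stmt_2 {V : Type*} [Fintype V] [DecidableEq V]
    (G : SimpleGraph V) [DecidableRel G.Adj]
    (t n : ℕ) (ht : 2 ≤ t) (hn : Fintype.card V = n)
    (α : Finset V → ℕ)
    (hα : ∀ T : Finset V,
      α T = sSup {k : ℕ | ∃ S : Finset V, G.IsNClique k S ∧ T ⊆ S}) :
    (∀ T ∈ G.cliqueFinset t, t ≤ α T) ∧
      ∑ T ∈ G.cliqueFinset t, ((α T : ℝ) ^ t / ((α T).choose t : ℝ)) ≤ (n : ℝ) ^ t := by
  have hle : ∀ S T : Finset V, G.IsClique S → T ⊆ S → S.card ≤ α T := by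
    intro S T hS hTS
    rw [hα]
    refine le_csSup ⟨Fintype.card V, ?_⟩ ⟨S, ⟨hS, rfl⟩, hTS⟩
    rintro k ⟨U, hU, -⟩
    rw [← hU.card_eq]
    exact Finset.card_le_univ U
  refine ⟨?_, ?_⟩
  · intro T hT
    rw [SimpleGraph.mem_cliqueFinset_iff, SimpleGraph.isNClique_iff] at hT
    rw [← hT.2]
    exact hle T T hT.1 subset_rfl
  · have := lagrangian G t (fun T => (α T : ℝ) ^ t / ((α T).choose t : ℝ)) (by
      intro S T hS hTS hT
      exact weight_anti _ _ _ (hT ▸ Finset.card_le_card hTS) (hle S T hS hTS))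
      _ (fun _ => 1) (fun _ => zero_le_one) le_rfl
    simpa [hn] using this
end

section
/- Let t ≥ 2 and let G be a graph on n vertices. For each t-clique T of G define β_G(T) to be the largest k such that all vertices of T lie on a subgraph of G isomorphic to the path P_{k+1}, and define p_G(T) = 1 / C(β_G(T), t-1). Then β_G(T) ≥ t-1 for every t-clique T (so p_G(T) is well-defined), the sum of p_G(T) over all t-cliques T of G is at most n/t, and equality holds if and only if G is a disjoint union of complete graphs each of order at least t. -/
set_option linter.unusedSectionVars false

namespace LocPath

variable {V : Type*} [Fintype V] [DecidableEq V] (G : SimpleGraph V) [DecidableRel G.Adj]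

/-- A (list-encoded) path of `G` inside the vertex set `S`. -/
def IsP (S : Finset V) (l : List V) : Prop :=
  l.Nodup ∧ l.IsChain G.Adj ∧ ∀ x ∈ l, x ∈ S

/-- The possible lengths of paths inside `S` through all of `T`. -/
def lens (S T : Finset V) : Set ℕ :=
  {k | ∃ l, IsP G S l ∧ (∀ x ∈ T, x ∈ l) ∧ l.length = k + 1}

/-- The longest path length inside `S` through `T`. -/
noncomputable def b (S T : Finset V) : ℕ := sSup (lens G S T)

/-- The `t`-cliques inside `S`. -/
def K (t : ℕ) (S : Finset V) : Finset (Finset V) :=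
  (G.cliqueFinset t).filter (fun T => T ⊆ S)

/-- Neighbours inside `S`. -/
def N (S : Finset V) (v : V) : Finset V := S.filter (fun w => G.Adj v w)

/-- The weight of a clique. -/
noncomputable def p (t : ℕ) (S T : Finset V) : ℝ := (1 : ℝ) / ((b G S T).choose (t - 1) : ℝ)

/-- Disjoint union of cliques of order at least `t`. -/
def Good (t : ℕ) (S : Finset V) : Prop :=
  (∀ u ∈ S, ∀ v ∈ S, ∀ w ∈ S, G.Adj u v → G.Adj v w → u ≠ w → G.Adj u w) ∧
    ∀ v ∈ S, t ≤ (N G S v).card + 1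

variable {G}

lemma IsP.length_le {S : Finset V} {l : List V} (h : IsP G S l) : l.length ≤ S.card := by
  rw [← List.toFinset_card_of_nodup h.1]
  apply Finset.card_le_card
  intro x hx
  exact h.2.2 x (by simpa using hx)

lemma IsP.reverse {S : Finset V} {l : List V} (h : IsP G S l) : IsP G S l.reverse := by
  refine ⟨List.nodup_reverse.2 h.1, ?_, ?_⟩
  · rw [List.isChain_reverse]
    exact h.2.1.imp (fun _ _ h => h.symm)
  · intro x hx
    exact h.2.2 x (by simpa using hx)

lemma IsP.mono {S S' : Finset V} {l : List V} (h : IsP G S l) (hS : S ⊆ S') : IsP G S' l :=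
  ⟨h.1, h.2.1, fun x hx => hS (h.2.2 x hx)⟩

lemma bdd (S T : Finset V) : BddAbove (lens G S T) := by
  refine ⟨S.card, ?_⟩
  rintro k ⟨l, h, -, hl⟩
  have := h.length_le
  omega

lemma le_b {S T : Finset V} {k : ℕ} {l : List V} (h : IsP G S l) (hT : ∀ x ∈ T, x ∈ l)
    (hl : l.length = k + 1) : k ≤ b G S T :=
  le_csSup (bdd S T) ⟨l, h, hT, hl⟩

lemma clique_path {S T : Finset V} (hT : G.IsClique T) (hS : T ⊆ S) : IsP G S T.toList := by
  refine ⟨T.nodup_toList, ?_, fun x hx => hS (by simpa using hx)⟩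
  apply List.Pairwise.isChain
  have h := T.nodup_toList
  have h2 : ∀ x ∈ T.toList, x ∈ T := by simp
  generalize T.toList = l at h h2
  induction l with
  | nil => simp
  | cons a r ih =>
    rw [List.nodup_cons] at h
    rw [List.pairwise_cons]
    refine ⟨fun c hc => hT (h2 a (by simp)) (h2 c (by simp [hc])) ?_, ih h.2 ?_⟩
    · rintro rfl; exact h.1 hc
    · intro x hx; exact h2 x (by simp [hx])

lemma clique_le_b {S T : Finset V} {t : ℕ} (ht : 1 ≤ t) (hT : G.IsClique T) (hS : T ⊆ S)
    (hc : T.card = t) : t - 1 ≤ b G S T := by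
  apply le_b (clique_path hT hS) (by simp)
  simp; omega

lemma b_attained {S T : Finset V} (hT : G.IsClique T) (hS : T ⊆ S) (hc : 1 ≤ T.card) :
    ∃ l, IsP G S l ∧ (∀ x ∈ T, x ∈ l) ∧ l.length = b G S T + 1 := by
  have : (lens G S T).Nonempty :=
    ⟨T.card - 1, T.toList, clique_path hT hS, by simp, by simp; omega⟩
  exact Nat.sSup_mem this (bdd S T)

lemma b_mono {S S' T : Finset V} (hT : G.IsClique T) (hS : T ⊆ S) (hc : 1 ≤ T.card)
    (h : S ⊆ S') : b G S T ≤ b G S' T := by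
  obtain ⟨l, h1, h2, h3⟩ := b_attained hT hS hc
  exact le_b (h1.mono h) h2 h3

/-- `l` is a longest path in `S`. -/
def Longest (G : SimpleGraph V) (S : Finset V) (l : List V) : Prop :=
  IsP G S l ∧ ∀ l', IsP G S l' → l'.length ≤ l.length

lemma exists_longest (G : SimpleGraph V) [DecidableRel G.Adj] (S : Finset V) (hS : S.Nonempty) :
    ∃ l, Longest G S l ∧ l ≠ [] := by
  obtain ⟨v, hv⟩ := hS
  have hne : {k | ∃ l, IsP G S l ∧ l.length = k}.Nonempty :=
    ⟨1, [v], ⟨by simp, by simp, by simpa using hv⟩, rfl⟩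
  have hb : BddAbove {k | ∃ l, IsP G S l ∧ l.length = k} := by
    refine ⟨S.card, ?_⟩
    rintro k ⟨l, h, rfl⟩
    exact h.length_le
  obtain ⟨l, h1, h2⟩ := Nat.sSup_mem hne hb
  have hmax : ∀ l', IsP G S l' → l'.length ≤ l.length := fun l' h' => by
    rw [h2]; exact le_csSup hb ⟨l', h', rfl⟩
  refine ⟨l, ⟨h1, hmax⟩, ?_⟩
  rintro rfl
  have := hmax [v] ⟨by simp, by simp, by simpa using hv⟩
  simp at this

lemma b_longest {S T : Finset V} {l : List V} {k : ℕ} (hl : Longest G S l)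
    (hk : l.length = k + 1) (hT : G.IsClique T) (hS : T ⊆ S) (hc : 1 ≤ T.card)
    (hTl : ∀ x ∈ T, x ∈ l) : b G S T = k := by
  apply le_antisymm
  · obtain ⟨l', h1, h2, h3⟩ := b_attained hT hS hc
    have := hl.2 l' h1
    omega
  · exact le_b hl.1 hTl hk

lemma Longest.reverse {S : Finset V} {l : List V} (h : Longest G S l) : Longest G S l.reverse :=
  ⟨h.1.reverse, by simpa using h.2⟩

lemma head_closed {S : Finset V} {a : V} {r : List V} (h : Longest G S (a :: r)) {y : V}
    (hy : y ∈ S) (hay : G.Adj a y) : y ∈ a :: r := by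
  by_contra hn
  have := h.2 (y :: a :: r) ⟨List.nodup_cons.2 ⟨hn, h.1.1⟩,
    List.isChain_cons_cons.2 ⟨hay.symm, h.1.2.1⟩, by
      intro x hx
      rcases List.mem_cons.1 hx with rfl | hx
      · exact hy
      · exact h.1.2.2 x hx⟩
  simp at this

lemma last_closed {S : Finset V} {z : V} {r : List V} (h : Longest G S (r ++ [z])) {y : V}
    (hy : y ∈ S) (hay : G.Adj z y) : y ∈ r ++ [z] := by
  have h' := h.reverse
  simp only [List.reverse_append, List.reverse_cons, List.reverse_nil, List.nil_append,
    List.singleton_append] at h'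
  have := head_closed h' hy hay
  simpa [or_comm] using this

/-- A longest path whose ends are adjacent spans a closed set. -/
lemma cycle_closed {S : Finset V} {c : List V} (h : Longest G S c)
    (hc : ∀ x ∈ c.getLast?, ∀ y ∈ c.head?, G.Adj x y) {x y : V} (hx : x ∈ c) (hy : y ∈ S)
    (hxy : G.Adj x y) : y ∈ c := by
  by_contra hn
  obtain ⟨c1, c2, rfl⟩ := List.append_of_mem hx
  have hP : IsP G S (y :: (x :: c2 ++ c1)) := by
    have hperm : (x :: c2 ++ c1).Perm (c1 ++ x :: c2) := List.perm_append_comm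
    refine ⟨List.nodup_cons.2 ⟨fun h' => hn (hperm.mem_iff.1 h'), hperm.nodup_iff.2 h.1.1⟩, ?_, ?_⟩
    · rw [List.cons_append, List.isChain_cons_cons, ← List.cons_append]
      refine ⟨hxy.symm, ?_⟩
      have h2 := h.1.2.1
      rw [List.isChain_append] at h2 ⊢
      refine ⟨h2.2.1, h2.1, ?_⟩
      intro u hu v hv
      apply hc u _ v _
      · rw [List.getLast?_append]; simp [Option.mem_def.1 hu]
      · rw [List.head?_append]; simp [Option.mem_def.1 hv]
    · intro u hu
      rcases List.mem_cons.1 hu with rfl | hu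
      · exact hy
      · exact h.1.2.2 u (hperm.mem_iff.1 hu)
  have := h.2 _ hP
  simp at this
  omega

lemma rotate_closed {S : Finset V} {l p q : List V} (h : Longest G S l) (hl : l = p ++ q)
    {v0 vi vj vk : V} (h0 : p.head? = some v0) (hi : p.getLast? = some vi)
    (hj : q.head? = some vj) (hk : q.getLast? = some vk)
    (h1 : G.Adj v0 vj) (h2 : G.Adj vi vk) {x y : V} (hx : x ∈ l) (hy : y ∈ S)
    (hxy : G.Adj x y) : y ∈ l := by
  subst hl
  have hperm : (p ++ q.reverse).Perm (p ++ q) := (List.reverse_perm q).append_left p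
  have hP : Longest G S (p ++ q.reverse) := by
    refine ⟨⟨hperm.nodup_iff.2 h.1.1, ?_, fun u hu => h.1.2.2 u (hperm.mem_iff.1 hu)⟩, ?_⟩
    · have h3 := h.1.2.1
      rw [List.isChain_append] at h3 ⊢
      refine ⟨h3.1, ?_, ?_⟩
      · rw [List.isChain_reverse]
        exact h3.2.1.imp (fun _ _ h => h.symm)
      · intro u hu v hv
        rw [hi] at hu
        rw [List.head?_reverse, hk] at hv
        simp at hu hv
        subst hu; subst hv; exact h2
    · intro l' hl'
      rw [hperm.length_eq]; exact h.2 l' hl'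
  apply hperm.mem_iff.1
  refine cycle_closed hP ?_ (hperm.mem_iff.2 hx) hy hxy
  intro u hu v hv
  rw [List.getLast?_append, List.getLast?_reverse, hj] at hu
  rw [List.head?_append, h0] at hv
  simp at hu hv
  subst hu; subst hv; exact h1.symm

/-- The set spanned by a longest path is closed, or an end has small degree. -/
lemma dichotomy {S : Finset V} {l : List V} (h : Longest G S l) (hne : l ≠ []) :
    (∀ x ∈ l, ∀ y ∈ S, G.Adj x y → y ∈ l) ∨
    ∃ a r, Longest G S (a :: r) ∧ 2 * (N G S a).card ≤ r.length := by
  by_cases hcl : ∀ x ∈ l, ∀ y ∈ S, G.Adj x y → y ∈ l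
  · exact Or.inl hcl
  right
  obtain ⟨a, r, rfl⟩ := List.exists_cons_of_ne_nil hne
  obtain ⟨r', z, hz⟩ : ∃ r' z, a :: r = r' ++ [z] :=
    ⟨(a :: r).dropLast, (a :: r).getLast hne, (List.dropLast_append_getLast hne).symm⟩
  have hlen : r'.length = r.length := by
    have := congrArg List.length hz
    simpa using this.symm
  set k := r.length with hk
  set f : ℕ → V := fun i => (a :: r).getD i a with hf
  set A := (Finset.range k).filter (fun i => G.Adj a (f (i+1))) with hA
  set B := (Finset.range k).filter (fun i => G.Adj z (f i)) with hB
  have hAc : (N G S a).card ≤ A.card := by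
    refine le_trans (Finset.card_le_card ?_) (Finset.card_image_le (s := A) (f := fun i => f (i+1)))
    intro y hy
    simp only [N, Finset.mem_filter] at hy
    have hy1 := head_closed h hy.1 hy.2
    have hy2 : y ∈ r := by
      rcases List.mem_cons.1 hy1 with h' | h'
      · subst h'; exact absurd hy.2 (G.loopless.irrefl _)
      · exact h'
    obtain ⟨i, hi, rfl⟩ := List.mem_iff_getElem.1 hy2
    refine Finset.mem_image.2 ⟨i, ?_, ?_⟩
    · simp only [hA, Finset.mem_filter, Finset.mem_range]
      refine ⟨hi, ?_⟩
      simpa [hf, hi] using hy.2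
    · simp [hf, hi]
  have hBc : (N G S z).card ≤ B.card := by
    refine le_trans (Finset.card_le_card ?_) (Finset.card_image_le (s := B) (f := f))
    intro y hy
    simp only [N, Finset.mem_filter] at hy
    have hy1 := last_closed (hz ▸ h) hy.1 hy.2
    have hy2 : y ∈ r' := by
      rcases List.mem_append.1 hy1 with h' | h'
      · exact h'
      · simp at h'; subst h'; exact absurd hy.2 (G.loopless.irrefl _)
    obtain ⟨i, hi, rfl⟩ := List.mem_iff_getElem.1 hy2
    have hfi : f i = r'[i] := by
      simp only [hf]
      rw [hz]
      simp [List.getD, List.getElem?_append, hi]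
    refine Finset.mem_image.2 ⟨i, ?_, hfi⟩
    simp only [hB, Finset.mem_filter, Finset.mem_range]
    exact ⟨by omega, hfi ▸ hy.2⟩
  have hdisj : Disjoint A B := by
    rw [Finset.disjoint_left]
    intro i hiA hiB
    simp only [hA, hB, Finset.mem_filter, Finset.mem_range] at hiA hiB
    apply hcl
    intro x hx y hy hxy
    have hlt : i + 1 < (a :: r).length := by simp; omega
    refine rotate_closed h (List.take_append_drop (i+1) (a :: r)).symm (v0 := a) (vi := f i)
      (vj := f (i+1)) (vk := z) ?_ ?_ ?_ ?_ hiA.2 hiB.2.symm hx hy hxy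
    · simp
    · rw [List.getLast?_take]
      have : i < (a :: r).length := by omega
      simp only [hf, List.getD, Nat.add_sub_cancel]
      rw [List.getElem?_eq_getElem this]
      simp
    · rw [List.head?_drop]
      simp only [hf, List.getD]
      rw [List.getElem?_eq_getElem hlt]
      simp
    · rw [List.getLast?_drop, if_neg (by omega), hz]; simp
  have hsum : A.card + B.card ≤ k := by
    rw [← Finset.card_union_of_disjoint hdisj]
    refine le_trans (Finset.card_le_card (Finset.union_subset (Finset.filter_subset _ _)
      (Finset.filter_subset _ _))) ?_
    simp
  by_cases h2 : 2 * (N G S a).card ≤ k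
  · exact ⟨a, r, h, h2⟩
  · refine ⟨z, r'.reverse, ?_, ?_⟩
    · have := h.reverse
      rw [hz] at this
      simpa using this
    · simp [hlen]; omega

lemma chain_closed {R : Finset V} {l : List V} (hl : l.IsChain G.Adj)
    (hR : ∀ x ∈ l, ∀ y ∈ l, G.Adj x y → x ∈ R → y ∈ R) :
    (∀ x ∈ l, x ∈ R) ∨ (∀ x ∈ l, x ∉ R) := by
  induction l with
  | nil => simp
  | cons a r ih =>
    cases r with
    | nil => simpa using em (a ∈ R)
    | cons c r =>
      rw [List.isChain_cons_cons] at hl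
      have h1 := hR a (by simp) c (by simp) hl.1
      have h2 := hR c (by simp) a (by simp) hl.1.symm
      rcases ih hl.2 (fun x hx y hy => hR x (List.mem_cons_of_mem _ hx) y
        (List.mem_cons_of_mem _ hy)) with h | h
      · left
        intro x hx
        rcases List.mem_cons.1 hx with rfl | hx
        · exact h2 (h c (by simp))
        · exact h x hx
      · right
        intro x hx
        rcases List.mem_cons.1 hx with rfl | hx
        · exact fun hh => h c (by simp) (h1 hh)
        · exact h x hx

lemma chain_clique {S : Finset V} {l : List V} (hl : IsP G S l)
    (hS : ∀ u ∈ S, ∀ v ∈ S, ∀ w ∈ S, G.Adj u v → G.Adj v w → u ≠ w → G.Adj u w) :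
    ∀ x ∈ l, ∀ y ∈ l, x ≠ y → G.Adj x y := by
  induction l with
  | nil => simp
  | cons a r ih =>
    obtain ⟨h1, h2, h3⟩ := hl
    have key : ∀ y ∈ r, G.Adj a y := by
      cases r with
      | nil => simp
      | cons c r =>
        rw [List.isChain_cons_cons] at h2
        intro y hy
        by_cases hyc : y = c
        · subst hyc; exact h2.1
        · have := ih ⟨(List.nodup_cons.1 h1).2, h2.2, fun x hx => h3 x (List.mem_cons_of_mem _ hx)⟩
            c (by simp) y hy (Ne.symm hyc)
          refine hS a (h3 a (by simp)) c (h3 c (by simp)) y (h3 y (List.mem_cons_of_mem _ hy))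
            h2.1 this ?_
          rintro rfl
          exact (List.nodup_cons.1 h1).1 hy
    have ih' := ih ⟨(List.nodup_cons.1 h1).2, h2.tail, fun x hx => h3 x (List.mem_cons_of_mem _ hx)⟩
    intro x hx y hy hxy
    rcases List.mem_cons.1 hx with rfl | hxr
    · rcases List.mem_cons.1 hy with rfl | hy
      · exact absurd rfl hxy
      · exact key y hy
    · rcases List.mem_cons.1 hy with rfl | hyr
      · exact (key x hxr).symm
      · exact ih' x hxr y hyr hxy

lemma mem_K {t : ℕ} {S T : Finset V} :
    T ∈ K G t S ↔ G.IsClique T ∧ T.card = t ∧ T ⊆ S := by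
  simp [K, SimpleGraph.mem_cliqueFinset_iff, SimpleGraph.isNClique_iff, and_assoc]

lemma card_K_le (t : ℕ) (S : Finset V) : (K G t S).card ≤ S.card.choose t := by
  rw [← Finset.card_powersetCard]
  apply Finset.card_le_card
  intro T hT
  rw [mem_K] at hT
  exact Finset.mem_powersetCard.2 ⟨hT.2.2, hT.2.1⟩

lemma card_K_eq_iff {t : ℕ} {S : Finset V} (ht : 2 ≤ t) (hS : t ≤ S.card) :
    (K G t S).card = S.card.choose t ↔ G.IsClique (S : Set V) := by
  have hsub : K G t S ⊆ S.powersetCard t := by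
    intro T hT
    rw [mem_K] at hT
    exact Finset.mem_powersetCard.2 ⟨hT.2.2, hT.2.1⟩
  constructor
  · intro h
    have heq := Finset.eq_of_subset_of_card_le hsub (by rw [Finset.card_powersetCard, h])
    intro x hx y hy hxy
    obtain ⟨T, hT1, hT2, hT3⟩ := Finset.exists_subsuperset_card_eq (s := {x, y}) (t := S) (n := t)
      (by
        intro u hu
        simp only [Finset.mem_insert, Finset.mem_singleton] at hu
        rcases hu with rfl | rfl
        · exact hx
        · exact hy) (by rw [Finset.card_pair hxy]; exact ht) hS
    have : T ∈ K G t S := by rw [heq]; exact Finset.mem_powersetCard.2 ⟨hT2, hT3⟩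
    exact (mem_K.1 this).1 (hT1 (by simp)) (hT1 (by simp)) hxy
  · intro h
    rw [← Finset.card_powersetCard]
    congr 1
    apply Finset.Subset.antisymm hsub
    intro T hT
    rw [Finset.mem_powersetCard] at hT
    exact mem_K.2 ⟨h.subset (by exact_mod_cast hT.1), hT.2, hT.1⟩

lemma path_part {t k : ℕ} {l : List V} {R : Finset V} (ht : 2 ≤ t) (hl : IsP G R l)
    (hk : l.length = k + 1) (hR : R = l.toFinset) :
    ((K G t R).card : ℝ) / (k.choose (t-1) : ℝ) ≤ (R.card : ℝ) / t ∧
    (((K G t R).card : ℝ) / (k.choose (t-1) : ℝ) = (R.card : ℝ) / t ↔ Good G t R) := by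
  have hRc : R.card = k + 1 := by rw [hR, List.toFinset_card_of_nodup hl.1, hk]
  have ht0 : (0:ℝ) < t := by positivity
  have hle := card_K_le (G := G) t R
  have hNle : ∀ v ∈ R, (N G R v).card + 1 ≤ R.card := by
    intro v hv
    have : (insert v (N G R v)).card ≤ R.card := Finset.card_le_card (by
      intro x hx
      rcases Finset.mem_insert.1 hx with rfl | hx
      · exact hv
      · exact (Finset.mem_filter.1 hx).1)
    rwa [Finset.card_insert_of_notMem (by simp [N])] at this
  have hRne : R.Nonempty := by rw [← Finset.card_pos]; omega
  by_cases hkt : t ≤ k + 1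
  · have hid := Nat.add_one_mul_choose_eq k (t-1)
    rw [Nat.sub_add_cancel (by omega)] at hid
    have hpos : 0 < k.choose (t-1) := Nat.choose_pos (by omega)
    have hpos' : (0:ℝ) < k.choose (t-1) := by exact_mod_cast hpos
    have hid' : ((k+1 : ℕ) : ℝ) * k.choose (t-1) = (k+1).choose t * t := by exact_mod_cast hid
    have hle' : ((K G t R).card : ℝ) ≤ (k+1).choose t := by rw [hRc] at hle; exact_mod_cast hle
    rw [hRc]
    constructor
    · rw [div_le_div_iff₀ hpos' ht0, hid']
      gcongr
    · rw [div_eq_div_iff hpos'.ne' ht0.ne', hid', mul_left_inj' ht0.ne']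
      have : (((K G t R).card : ℝ) = (k+1).choose t) ↔ (K G t R).card = R.card.choose t := by
        rw [hRc]; exact Nat.cast_inj
      rw [this, card_K_eq_iff ht (by omega)]
      constructor
      · intro h
        refine ⟨fun u hu v hv w hw _ _ huw => h hu hw huw, fun v hv => ?_⟩
        have : N G R v = R.erase v := by
          ext w
          simp only [N, Finset.mem_filter, Finset.mem_erase]
          exact ⟨fun hw => ⟨hw.2.ne', hw.1⟩, fun hw => ⟨hw.2, h hv hw.2 (Ne.symm hw.1)⟩⟩
        rw [this, Finset.card_erase_of_mem hv]
        omega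
      · intro h x hx y hy hxy
        have := chain_clique hl h.1
        exact this x (by simpa [hR] using hx) y (by simpa [hR] using hy) hxy
  · have h0 : (K G t R).card = 0 := by
      rw [hRc, Nat.choose_eq_zero_of_lt (by omega)] at hle
      omega
    rw [h0, hRc]
    have : (0:ℝ) < ((k+1 : ℕ) : ℝ) / t := by positivity
    simp only [Nat.cast_zero, zero_div]
    refine ⟨this.le, fun h => absurd h this.ne, fun h => ?_⟩
    obtain ⟨v, hv⟩ := hRne
    have h1 := h.2 v hv
    have h2 := hNle v hv
    omega

lemma choose_half (d j : ℕ) : 2 ^ j * d.choose j ≤ (2 * d).choose j := by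
  induction j with
  | zero => simp
  | succ j ih =>
    have h1 := Nat.choose_succ_right_eq d j
    have h2 := Nat.choose_succ_right_eq (2 * d) j
    apply Nat.le_of_mul_le_mul_right (c := j + 1) _ (by omega)
    calc 2 ^ (j+1) * d.choose (j+1) * (j+1) = 2 ^ (j+1) * (d.choose (j+1) * (j+1)) := by ring
      _ = (2 ^ j * d.choose j) * (2 * (d - j)) := by rw [h1]; ring
      _ ≤ (2 * d).choose j * (2 * d - j) := Nat.mul_le_mul ih (by omega)
      _ = _ := h2.symm

lemma choose_ratio {t d k : ℕ} (ht : 2 ≤ t) (hd : 2 * d ≤ k) :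
    t * d.choose (t-1) ≤ k.choose (t-1) := by
  have h1 : t ≤ 2 ^ (t-1) := by
    have := Nat.lt_two_pow_self (n := t - 1)
    omega
  calc t * d.choose (t-1) ≤ 2 ^ (t-1) * d.choose (t-1) := Nat.mul_le_mul_right _ h1
    _ ≤ (2*d).choose (t-1) := choose_half _ _
    _ ≤ _ := Nat.choose_le_choose _ hd

lemma p_mono {t : ℕ} {S S' T : Finset V} (ht : 2 ≤ t) (hT : T ∈ K G t S') (h : S' ⊆ S) :
    p G t S T ≤ p G t S' T := by
  rw [mem_K] at hT
  have h1 := clique_le_b (G := G) (by omega) hT.1 hT.2.2 hT.2.1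
  have h2 := b_mono (G := G) hT.1 hT.2.2 (by omega) h
  have : 0 < (b G S' T).choose (t-1) := Nat.choose_pos h1
  unfold p
  apply one_div_le_one_div_of_le
  · exact_mod_cast this
  · exact_mod_cast Nat.choose_le_choose _ h2

lemma good_split {t : ℕ} {S R : Finset V} (hRS : R ⊆ S)
    (hcl : ∀ x ∈ R, ∀ y ∈ S, G.Adj x y → y ∈ R) :
    Good G t S ↔ Good G t R ∧ Good G t (S \ R) := by
  have hcl' : ∀ x ∈ S, x ∉ R → ∀ y ∈ S, G.Adj x y → y ∉ R :=
    fun x hx hxR y _ hxy hyR => hxR (hcl y hyR x hx hxy.symm)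
  have hN1 : ∀ v ∈ R, N G R v = N G S v := by
    intro v hv
    ext w
    simp only [N, Finset.mem_filter]
    exact ⟨fun h => ⟨hRS h.1, h.2⟩, fun h => ⟨hcl v hv w h.1 h.2, h.2⟩⟩
  have hN2 : ∀ v ∈ S, v ∉ R → N G (S \ R) v = N G S v := by
    intro v hv hvR
    ext w
    simp only [N, Finset.mem_filter, Finset.mem_sdiff]
    exact ⟨fun h => ⟨h.1.1, h.2⟩, fun h => ⟨⟨h.1, hcl' v hv hvR w h.1 h.2⟩, h.2⟩⟩
  constructor
  · intro h
    refine ⟨⟨fun u hu v hv w hw => h.1 u (hRS hu) v (hRS hv) w (hRS hw), fun v hv => ?_⟩,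
      ⟨fun u hu v hv w hw => h.1 u (Finset.mem_sdiff.1 hu).1 v (Finset.mem_sdiff.1 hv).1 w
        (Finset.mem_sdiff.1 hw).1, fun v hv => ?_⟩⟩
    · rw [hN1 v hv]; exact h.2 v (hRS hv)
    · rw [Finset.mem_sdiff] at hv
      rw [hN2 v hv.1 hv.2]; exact h.2 v hv.1
  · rintro ⟨h1, h2⟩
    refine ⟨fun u hu v hv w hw huv hvw huw => ?_, fun v hv => ?_⟩
    · by_cases huR : u ∈ R
      · have hvR := hcl u huR v hv huv
        exact h1.1 u huR v hvR w (hcl v hvR w hw hvw) huv hvw huw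
      · have hvR := hcl' u hu huR v hv huv
        exact h2.1 u (Finset.mem_sdiff.2 ⟨hu, huR⟩) v (Finset.mem_sdiff.2 ⟨hv, hvR⟩) w
          (Finset.mem_sdiff.2 ⟨hw, hcl' v hv hvR w hw hvw⟩) huv hvw huw
    · by_cases hvR : v ∈ R
      · rw [← hN1 v hvR]; exact h1.2 v hvR
      · rw [← hN2 v hv hvR]; exact h2.2 v (Finset.mem_sdiff.2 ⟨hv, hvR⟩)

lemma closed_sum {t k : ℕ} {S : Finset V} {l : List V} (ht : 2 ≤ t) (hl : Longest G S l)
    (hk : l.length = k + 1) (hcl : ∀ x ∈ l, ∀ y ∈ S, G.Adj x y → y ∈ l) :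
    ∑ T ∈ K G t S, p G t S T = ((K G t l.toFinset).card : ℝ) / (k.choose (t-1) : ℝ) +
      ∑ T ∈ K G t (S \ l.toFinset), p G t (S \ l.toFinset) T := by
  set R := l.toFinset with hR
  have hmem : ∀ x, x ∈ R ↔ x ∈ l := by simp [hR]
  have hRS : R ⊆ S := fun x hx => hl.1.2.2 x ((hmem x).1 hx)
  have hsplit : K G t S = K G t R ∪ K G t (S \ R) := by
    ext T
    simp only [Finset.mem_union, mem_K]
    constructor
    · rintro ⟨h1, h2, h3⟩
      by_cases hx : ∃ x ∈ T, x ∈ R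
      · left
        obtain ⟨x, hxT, hxR⟩ := hx
        refine ⟨h1, h2, fun y hy => ?_⟩
        by_cases hxy : x = y
        · exact hxy ▸ hxR
        · exact (hmem y).2 (hcl x ((hmem x).1 hxR) y (h3 hy) (h1 hxT hy hxy))
      · right
        push Not at hx
        exact ⟨h1, h2, fun y hy => Finset.mem_sdiff.2 ⟨h3 hy, hx y hy⟩⟩
    · rintro (⟨h1, h2, h3⟩ | ⟨h1, h2, h3⟩)
      · exact ⟨h1, h2, h3.trans hRS⟩
      · exact ⟨h1, h2, h3.trans Finset.sdiff_subset⟩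
  have hdisj : Disjoint (K G t R) (K G t (S \ R)) := by
    rw [Finset.disjoint_left]
    intro T h1 h2
    rw [mem_K] at h1 h2
    obtain ⟨x, hx⟩ : T.Nonempty := by rw [← Finset.card_pos]; omega
    exact (Finset.mem_sdiff.1 (h2.2.2 hx)).2 (h1.2.2 hx)
  rw [hsplit, Finset.sum_union hdisj]
  congr 1
  · rw [Finset.sum_congr rfl (g := fun _ => (1:ℝ) / (k.choose (t-1) : ℝ))]
    · rw [Finset.sum_const, nsmul_eq_mul]; ring
    · intro T hT
      rw [mem_K] at hT
      have := b_longest hl hk hT.1 (hT.2.2.trans hRS) (by omega)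
        (fun x hx => (hmem x).1 (hT.2.2 hx))
      simp only [p, this]
  · apply Finset.sum_congr rfl
    intro T hT
    rw [mem_K] at hT
    have : lens G S T = lens G (S \ R) T := by
      ext m
      constructor
      · rintro ⟨l', h1, h2, h3⟩
        refine ⟨l', ⟨h1.1, h1.2.1, ?_⟩, h2, h3⟩
        rcases chain_closed (R := R) h1.2.1 (fun x hx y hy hxy hxR =>
          (hmem y).2 (hcl x ((hmem x).1 hxR) y (h1.2.2 y hy) hxy)) with h | h
        · obtain ⟨x, hx⟩ : T.Nonempty := by rw [← Finset.card_pos]; omega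
          exact absurd (h x (h2 x hx)) (Finset.mem_sdiff.1 (hT.2.2 hx)).2
        · exact fun x hx => Finset.mem_sdiff.2 ⟨h1.2.2 x hx, h x hx⟩
      · rintro ⟨l', h1, h2, h3⟩
        exact ⟨l', h1.mono Finset.sdiff_subset, h2, h3⟩
    simp only [p, b, this]

lemma removal_sum {t : ℕ} {S : Finset V} {a : V} {r : List V} (ht : 2 ≤ t)
    (hl : Longest G S (a :: r)) (hd : 2 * (N G S a).card ≤ r.length) :
    ∑ T ∈ K G t S, p G t S T ≤ 1 / (t : ℝ) + ∑ T ∈ K G t (S.erase a), p G t S T := by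
  have ht0 : (0:ℝ) < t := by positivity
  rw [← Finset.sum_filter_add_sum_filter_not (K G t S) (fun T => a ∈ T)]
  have h2 : (K G t S).filter (fun T => ¬ a ∈ T) = K G t (S.erase a) := by
    ext T
    simp only [Finset.mem_filter, mem_K, Finset.subset_erase]
    tauto
  rw [h2]
  gcongr
  rw [Finset.sum_congr rfl (g := fun _ => (1:ℝ) / (r.length.choose (t-1) : ℝ))]
  · rw [Finset.sum_const, nsmul_eq_mul]
    set c := ((K G t S).filter (fun T => a ∈ T)).card with hc
    have hcle : c ≤ (N G S a).card.choose (t-1) := by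
      rw [← Finset.card_powersetCard, hc]
      apply Finset.card_le_card_of_injOn (fun T => T.erase a)
      · intro T hT
        simp only [Finset.coe_filter, Set.mem_ofPred_eq, mem_K] at hT
        obtain ⟨⟨h1, h2, h3⟩, h4⟩ := hT
        simp only [Finset.mem_coe, Finset.mem_powersetCard]
        refine ⟨fun x hx => ?_, by rw [Finset.card_erase_of_mem h4, h2]⟩
        rw [Finset.mem_erase] at hx
        exact Finset.mem_filter.2 ⟨h3 hx.2, h1 h4 hx.2 (Ne.symm hx.1)⟩
      · intro T hT T' hT' he
        simp only [Finset.coe_filter, Set.mem_ofPred_eq] at hT hT'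
        simp only at he
        rw [← Finset.insert_erase hT.2, he, Finset.insert_erase hT'.2]
    have hr := choose_ratio ht hd
    have : t * c ≤ r.length.choose (t-1) := le_trans (Nat.mul_le_mul_left _ hcle) hr
    have h' : (t:ℝ) * c ≤ (r.length.choose (t-1) : ℝ) := by exact_mod_cast this
    rcases Nat.eq_zero_or_pos (r.length.choose (t-1)) with h0 | h0
    · rw [h0]; simp
    · have h0' : (0:ℝ) < (r.length.choose (t-1) : ℝ) := by exact_mod_cast h0
      rw [mul_one_div, div_le_div_iff₀ h0' ht0]
      linarith
  · intro T hT
    simp only [Finset.mem_filter, mem_K] at hT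
    obtain ⟨⟨h1, h2, h3⟩, h4⟩ := hT
    have := b_longest hl (k := r.length) rfl h1 h3 (by omega) (fun x hx => by
      by_cases hax : a = x
      · simp [hax]
      · exact head_closed hl (h3 hx) (h1 h4 hx hax))
    simp only [p, this]

lemma removal_strict {t : ℕ} {S : Finset V} {a : V} {r : List V} (ht : 2 ≤ t)
    (hl : Longest G S (a :: r)) (hr : r ≠ []) (hg : Good G t (S.erase a)) :
    ∑ T ∈ K G t (S.erase a), p G t S T < ∑ T ∈ K G t (S.erase a), p G t (S.erase a) T := by
  have hnd := List.nodup_cons.1 hl.1.1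
  have hrP : IsP G (S.erase a) r := by
    refine ⟨hnd.2, hl.1.2.1.tail, fun x hx => Finset.mem_erase.2 ⟨?_, hl.1.2.2 x (by simp [hx])⟩⟩
    rintro rfl
    exact hnd.1 hx
  have hclq := chain_clique hrP hg.1
  obtain ⟨r', z, hz⟩ : ∃ r' z, r = r' ++ [z] :=
    ⟨r.dropLast, r.getLast hr, (List.dropLast_append_getLast hr).symm⟩
  have hzr : z ∈ r := by simp [hz]
  have hzc : ∀ y ∈ S.erase a, G.Adj z y → y ∈ r := by
    intro y hy hzy
    rw [Finset.mem_erase] at hy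
    have := last_closed (r := a :: r') (z := z) (by rw [List.cons_append, ← hz]; exact hl) hy.2 hzy
    rw [List.cons_append, ← hz] at this
    rcases List.mem_cons.1 this with h | h
    · exact absurd h hy.1
    · exact h
  have hcl : ∀ x ∈ r, ∀ y ∈ S.erase a, G.Adj x y → y ∈ r := by
    intro x hx y hy hxy
    by_cases hzx : z = x
    · subst hzx; exact hzc y hy hxy
    by_cases hzy : z = y
    · subst hzy; exact hzr
    exact hzc y hy (hg.1 z (hrP.2.2 z hzr) x (hrP.2.2 x hx) y hy (hclq z hzr x hx hzx) hxy hzy)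
  have hcard : t ≤ r.length := by
    have h1 := hg.2 z (hrP.2.2 z hzr)
    have h2 : insert z (N G (S.erase a) z) ⊆ r.toFinset := by
      intro x hx
      rw [List.mem_toFinset]
      rcases Finset.mem_insert.1 hx with rfl | hx
      · exact hzr
      · exact hzc x (Finset.mem_filter.1 hx).1 (Finset.mem_filter.1 hx).2
    have h3 := Finset.card_le_card h2
    rw [Finset.card_insert_of_notMem (by simp [N]), List.toFinset_card_of_nodup hrP.1] at h3
    omega
  obtain ⟨T, hT1, hT2⟩ := Finset.exists_subset_card_eq (s := r.toFinset) (n := t)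
    (by rw [List.toFinset_card_of_nodup hrP.1]; exact hcard)
  have hTr : ∀ x ∈ T, x ∈ r := fun x hx => by simpa using hT1 hx
  have hTK : T ∈ K G t (S.erase a) := mem_K.2
    ⟨fun x hx y hy hxy => hclq x (hTr x hx) y (hTr y hy) hxy, hT2, fun x hx => hrP.2.2 x (hTr x hx)⟩
  apply Finset.sum_lt_sum (fun T hT => p_mono ht hT (Finset.erase_subset _ _))
  refine ⟨T, hTK, ?_⟩
  rw [mem_K] at hTK
  have hb1 : b G S T = r.length := b_longest hl rfl hTK.1
    (hTK.2.2.trans (Finset.erase_subset _ _)) (by omega) (fun x hx => by simp [hTr x hx])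
  have hb2 : b G (S.erase a) T + 1 ≤ r.length := by
    obtain ⟨l', h1, h2, h3⟩ := b_attained (G := G) hTK.1 hTK.2.2 (by omega)
    rw [← h3, ← List.toFinset_card_of_nodup h1.1, ← List.toFinset_card_of_nodup hrP.1]
    apply Finset.card_le_card
    rcases chain_closed (R := r.toFinset) h1.2.1 (fun x hx y hy hxy hxR => by
      rw [List.mem_toFinset] at hxR ⊢
      exact hcl x hxR y (h1.2.2 y hy) hxy) with h | h
    · exact fun x hx => h x (by simpa using hx)
    · obtain ⟨x, hx⟩ : T.Nonempty := by rw [← Finset.card_pos]; omega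
      exact absurd (hT1 hx) (h x (h2 x hx))
  have hb3 := clique_le_b (G := G) (by omega) hTK.1 hTK.2.2 hT2
  unfold p
  rw [hb1]
  have hpos : 0 < (b G (S.erase a) T).choose (t-1) := Nat.choose_pos hb3
  apply one_div_lt_one_div_of_lt
  · exact_mod_cast hpos
  · have h1 : (b G (S.erase a) T + 1).choose (t-1) ≤ r.length.choose (t-1) :=
      Nat.choose_le_choose _ hb2
    have h2 : (b G (S.erase a) T + 1).choose (t-2+1) = _ := Nat.choose_succ_succ _ _
    have h3 : 0 < (b G (S.erase a) T).choose (t-2) := Nat.choose_pos (by omega)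
    have h4 : t - 2 + 1 = t - 1 := by omega
    rw [Nat.succ_eq_add_one, h4] at h2
    have : (b G (S.erase a) T).choose (t-1) < r.length.choose (t-1) := by omega
    exact_mod_cast this

theorem main {t : ℕ} (ht : 2 ≤ t) (m : ℕ) : ∀ S : Finset V, S.card = m →
    ∑ T ∈ K G t S, p G t S T ≤ (S.card : ℝ) / t ∧
    (∑ T ∈ K G t S, p G t S T = (S.card : ℝ) / t ↔ Good G t S) := by
  have ht0 : (0:ℝ) < t := by positivity
  induction m using Nat.strong_induction_on with
  | _ m ih =>
  intro S hSm
  rcases S.eq_empty_or_nonempty with rfl | hne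
  · have : K G t (∅ : Finset V) = ∅ := by
      ext T
      simp only [mem_K, Finset.subset_empty, Finset.notMem_empty, iff_false]
      rintro ⟨-, h2, rfl⟩
      simp at h2; omega
    rw [this]
    simp [Good]
  obtain ⟨l, hl, hlne⟩ := exists_longest G S hne
  rcases dichotomy hl hlne with hcl | ⟨a, r, hl', hd⟩
  · obtain ⟨k, hk⟩ : ∃ k, l.length = k + 1 :=
      ⟨l.length - 1, by have := List.length_pos_iff.2 hlne; omega⟩
    rw [closed_sum ht hl hk hcl]
    have hRS : l.toFinset ⊆ S := fun x hx => hl.1.2.2 x (by simpa using hx)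
    have hRc : 0 < l.toFinset.card := by rw [List.toFinset_card_of_nodup hl.1.1]; omega
    have hc := Finset.card_sdiff_add_card_eq_card hRS
    obtain ⟨h1, h2⟩ := path_part (G := G) (R := l.toFinset) ht
      ⟨hl.1.1, hl.1.2.1, fun x hx => by simpa using hx⟩ hk rfl
    obtain ⟨h3, h4⟩ := ih (S \ l.toFinset).card (by omega) (S \ l.toFinset) rfl
    have hsum : (S.card : ℝ) / t = (l.toFinset.card : ℝ) / t + ((S \ l.toFinset).card : ℝ) / t := by
      rw [← hc]; push_cast; ring
    rw [hsum, good_split hRS (fun x hx y hy hxy => by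
      rw [List.mem_toFinset] at hx ⊢; exact hcl x hx y hy hxy), ← h2, ← h4]
    refine ⟨add_le_add h1 h3, fun h => ⟨by linarith, by linarith⟩, fun h => by rw [h.1, h.2]⟩
  · have haS : a ∈ S := hl'.1.2.2 a (by simp)
    have hc := Finset.card_erase_add_one haS
    obtain ⟨h3, h4⟩ := ih (S.erase a).card (by omega) (S.erase a) rfl
    have hsum : (S.card : ℝ) / t = 1 / t + ((S.erase a).card : ℝ) / t := by
      rw [← hc]; push_cast; ring
    have hr := removal_sum ht hl' hd
    have hmono : ∑ T ∈ K G t (S.erase a), p G t S T ≤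
        ∑ T ∈ K G t (S.erase a), p G t (S.erase a) T :=
      Finset.sum_le_sum (fun T hT => p_mono ht hT (Finset.erase_subset _ _))
    have hnd := List.nodup_cons.1 hl'.1.1
    have hng : ¬ Good G t S := by
      intro hg
      have h5 := chain_clique hl'.1 hg.1
      have h6 : r.toFinset ⊆ N G S a := by
        intro x hx
        rw [List.mem_toFinset] at hx
        refine Finset.mem_filter.2 ⟨hl'.1.2.2 x (by simp [hx]), h5 a (by simp) x (by simp [hx]) ?_⟩
        rintro rfl
        exact hnd.1 hx
      have h7 := Finset.card_le_card h6
      rw [List.toFinset_card_of_nodup hnd.2] at h7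
      have h8 := hg.2 a haS
      omega
    rw [hsum]
    refine ⟨by linarith, fun h => ?_, fun h => absurd h hng⟩
    exfalso
    have hg : Good G t (S.erase a) := h4.1 (by linarith)
    by_cases hrn : r = []
    · subst hrn
      -- `a` has no neighbours, so no clique contains it
      have : K G t S = K G t (S.erase a) := by
        ext T
        simp only [mem_K, Finset.subset_erase]
        refine ⟨fun ⟨h1, h2, h3⟩ => ⟨h1, h2, h3, fun haT => ?_⟩, fun ⟨h1, h2, h3, _⟩ => ⟨h1, h2, h3⟩⟩
        obtain ⟨y, hy, hya⟩ := Finset.exists_mem_ne (s := T) (by omega) a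
        have := head_closed hl' (h3 hy) (h1 haT hy (Ne.symm hya))
        simp at this
        exact hya this
      rw [this] at h
      have : (0:ℝ) < 1 / t := by positivity
      linarith
    · have := removal_strict ht hl' hrn hg
      linarith

lemma lens_univ (T : Finset V) :
    {k : ℕ | ∃ S : G.Subgraph, ↑T ⊆ S.verts ∧
        Nonempty (S.coe ≃g SimpleGraph.pathGraph (k + 1))} = lens G Finset.univ T := by
  ext k
  simp only [Set.mem_ofPred_eq, lens]
  constructor
  · rintro ⟨S, hS, ⟨e⟩⟩
    refine ⟨List.ofFn (fun i : Fin (k+1) => (e.symm i : V)), ⟨?_, ?_, by simp⟩, ?_, by simp⟩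
    · rw [List.nodup_ofFn]
      exact Subtype.val_injective.comp e.symm.injective
    · rw [List.isChain_ofFn]
      intro i hi
      apply S.adj_sub
      have : S.coe.Adj (e.symm ⟨i, by omega⟩) (e.symm ⟨i+1, hi⟩) := by
        rw [e.symm.map_adj_iff, SimpleGraph.pathGraph_adj]
        left; rfl
      exact this
    · intro x hx
      rw [List.mem_ofFn]
      exact ⟨e ⟨x, hS hx⟩, by simp⟩
  · rintro ⟨l, hl, hT, hk⟩
    have hadj : ∀ i (h : i + 1 < l.length), G.Adj l[i] l[i+1] :=
      List.isChain_iff_getElem.1 hl.2.1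
    let f : SimpleGraph.Copy (SimpleGraph.pathGraph (k+1)) G :=
      ⟨⟨fun i => l[i.1]'(by omega), by
        intro i j hij
        rw [SimpleGraph.pathGraph_adj] at hij
        rcases hij with h | h
        · have := hadj i.1 (by omega)
          simpa only [h] using this
        · have := hadj j.1 (by omega)
          simpa only [h] using this.symm⟩, by
        intro i j hij
        have : l[i.1]'(by omega) = l[j.1]'(by omega) := hij
        exact Fin.ext ((List.Nodup.getElem_inj_iff hl.1).1 this)⟩
    refine ⟨f.toSubgraph, ?_, ⟨f.isoToSubgraph.symm⟩⟩
    intro x hx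
    obtain ⟨i, hi, rfl⟩ := List.mem_iff_getElem.1 (hT x hx)
    simp only [SimpleGraph.Subgraph.map_verts, SimpleGraph.Subgraph.verts_top, Set.image_univ]
    exact ⟨⟨i, by omega⟩, rfl⟩

lemma reach_adj (hS : ∀ u v w : V, G.Adj u v → G.Adj v w → u ≠ w → G.Adj u w) {v w : V}
    (h : G.Reachable v w) (hne : v ≠ w) : G.Adj v w := by
  obtain ⟨q⟩ := h
  induction q with
  | nil => exact absurd rfl hne
  | @cons u v w huv q ih =>
    by_cases hvw : v = w
    · subst hvw; exact huv
    · exact hS _ _ _ huv (ih hvw) hne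

lemma good_univ (t : ℕ) : Good G t Finset.univ ↔
    (∀ v w : V, G.Reachable v w → v ≠ w → G.Adj v w) ∧
        ∀ v : V, t ≤ Nat.card {w : V | G.Reachable v w} := by
  have hcard : (∀ v w : V, G.Reachable v w → v ≠ w → G.Adj v w) →
      ∀ v, Nat.card {w : V | G.Reachable v w} = (N G Finset.univ v).card + 1 := by
    intro h v
    have : {w : V | G.Reachable v w} = ((insert v (N G Finset.univ v) : Finset V) : Set V) := by
      ext w
      simp only [Set.mem_ofPred_eq, Finset.coe_insert, Set.mem_insert_iff, Finset.mem_coe, N,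
        Finset.mem_filter, Finset.mem_univ, true_and]
      constructor
      · intro hw
        by_cases hvw : v = w
        · exact Or.inl hvw.symm
        · exact Or.inr (h v w hw hvw)
      · rintro (rfl | hw)
        · exact SimpleGraph.Reachable.refl _
        · exact hw.reachable
    rw [this]
    simp only [Nat.card_eq_fintype_card, Finset.coe_sort_coe, Fintype.card_coe]
    rw [Finset.card_insert_of_notMem (by simp [N])]
  constructor
  · intro h
    have h1 : ∀ v w : V, G.Reachable v w → v ≠ w → G.Adj v w := fun v w => reach_adj
      (fun u v w => h.1 u (Finset.mem_univ _) v (Finset.mem_univ _) w (Finset.mem_univ _))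
    exact ⟨h1, fun v => by rw [hcard h1]; exact h.2 v (Finset.mem_univ _)⟩
  · rintro ⟨h1, h2⟩
    exact ⟨fun u _ v _ w _ huv hvw hne => h1 u w (huv.reachable.trans hvw.reachable) hne,
      fun v _ => by rw [← hcard h1]; exact h2 v⟩

end LocPath

theorem stmt_5 {V : Type*} [Fintype V] [DecidableEq V]
    (G : SimpleGraph V) [DecidableRel G.Adj]
    (t n : ℕ) (ht : 2 ≤ t) (hn : Fintype.card V = n)
    (β : Finset V → ℕ)
    (hβ : ∀ T : Finset V,
      β T = sSup {k : ℕ | ∃ S : G.Subgraph, ↑T ⊆ S.verts ∧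
        Nonempty (S.coe ≃g SimpleGraph.pathGraph (k + 1))}) :
    (∀ T ∈ G.cliqueFinset t, t - 1 ≤ β T) ∧
    ∑ T ∈ G.cliqueFinset t, (1 : ℝ) / ((β T).choose (t - 1) : ℝ) ≤ (n : ℝ) / t ∧
    (∑ T ∈ G.cliqueFinset t, (1 : ℝ) / ((β T).choose (t - 1) : ℝ) = (n : ℝ) / t ↔
      (∀ v w : V, G.Reachable v w → v ≠ w → G.Adj v w) ∧
        ∀ v : V, t ≤ Nat.card {w : V | G.Reachable v w}) := by
  have hb : ∀ T, β T = LocPath.b G Finset.univ T := fun T => by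
    rw [hβ, LocPath.lens_univ, LocPath.b]
  have hK : G.cliqueFinset t = LocPath.K G t Finset.univ := by
    simp [LocPath.K]
  have hm := LocPath.main (G := G) ht _ Finset.univ rfl
  rw [Finset.card_univ, hn, LocPath.good_univ] at hm
  rw [hK]
  simp only [hb]
  refine ⟨fun T hT => ?_, hm⟩
  rw [LocPath.mem_K] at hT
  exact LocPath.clique_le_b (by omega) hT.1 hT.2.2 hT.2.1
end

section
/- Let t ≥ 3 and let G be a graph with m edges. For each t-clique T of G define β_G(T) to be the largest k such that all vertices of T lie on a subgraph of G isomorphic to the path P_{k+1}, and define p'_G(T) = 1 / C(β_G(T) - 1, t-2). Then β_G(T) ≥ t-1 for every t-clique T (so p'_G(T) is well-defined), the sum of p'_G(T) over all t-cliques T of G is at most m / C(t, 2), and equality holds if and only if G is a disjoint union of complete graphs of order at least t together with any number of isolated vertices. -/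
open Finset

set_option linter.unusedSectionVars false

/-- `f` restricted to `0..k` is a path of length `k` in `G`. -/
def PathOn {V : Type*} (G : SimpleGraph V) (k : ℕ) (f : ℕ → V) : Prop :=
  (∀ i j, i ≤ k → j ≤ k → f i = f j → i = j) ∧ ∀ i, i < k → G.Adj (f i) (f (i + 1))

def IsP {V : Type*} (G : SimpleGraph V) (k : ℕ) (T : Finset V) : Prop :=
  ∃ f, PathOn G k f ∧ ∀ x ∈ T, ∃ i, i ≤ k ∧ f i = x

lemma isP_iff {V : Type*} (G : SimpleGraph V) (k : ℕ) (T : Finset V) :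
    (∃ S : G.Subgraph, ↑T ⊆ S.verts ∧ Nonempty (S.coe ≃g SimpleGraph.pathGraph (k + 1)))
      ↔ IsP G k T := by
  constructor
  · rintro ⟨S, hT, ⟨e⟩⟩
    refine ⟨fun i => if h : i < k + 1 then (e.symm ⟨i, h⟩ : V) else (e.symm 0 : V), ⟨?_, ?_⟩, ?_⟩
    · intro i j hi hj h
      simp only [Nat.lt_succ_of_le hi, Nat.lt_succ_of_le hj, dite_true] at h
      have := e.symm.injective (Subtype.ext h)
      simpa using this
    · intro i hi
      have h1 : i < k + 1 := by omega
      have h2 : i + 1 < k + 1 := by omega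
      simp only [h1, h2, dite_true]
      have : S.coe.Adj (e.symm ⟨i, h1⟩) (e.symm ⟨i+1, h2⟩) := by
        rw [e.symm.map_adj_iff, SimpleGraph.pathGraph_adj]
        simp
      exact S.adj_sub this
    · intro x hx
      refine ⟨(e ⟨x, hT hx⟩).val, by omega, ?_⟩
      have := (e ⟨x, hT hx⟩).isLt
      simp only [this, dite_true]
      simp
  · rintro ⟨f, ⟨hinj, hadj⟩, hT⟩
    let c : SimpleGraph.Copy (SimpleGraph.pathGraph (k+1)) G :=
      ⟨⟨fun i => f i.val, by
        intro a b hab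
        rw [SimpleGraph.pathGraph_adj] at hab
        rcases hab with h | h
        · rw [← h]; exact hadj _ (by omega)
        · rw [← h]; exact (hadj _ (by omega)).symm⟩, by
        intro a b hab
        exact Fin.ext (hinj _ _ (by omega) (by omega) hab)⟩
    refine ⟨c.toSubgraph, ?_, ⟨c.isoToSubgraph.symm⟩⟩
    intro x hx
    obtain ⟨i, hi, rfl⟩ := hT x hx
    simp only [SimpleGraph.Copy.toSubgraph, SimpleGraph.Subgraph.map_verts]
    exact ⟨⟨i, by omega⟩, trivial, rfl⟩

lemma PathOn.lt_card {V : Type*} [DecidableEq V] {G : SimpleGraph V} {k : ℕ} {f : ℕ → V}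
    (h : PathOn G k f) (S : Finset V) (hS : ∀ i, i ≤ k → f i ∈ S) : k + 1 ≤ S.card := by
  have : ((range (k+1)).image f).card = k + 1 := by
    rw [card_image_of_injOn, card_range]
    intro a ha b hb hab
    simp at ha hb
    exact h.1 a b (by omega) (by omega) hab
  rw [← this]
  apply card_le_card
  intro x hx
  simp only [mem_image, mem_range] at hx
  obtain ⟨i, hi, rfl⟩ := hx
  exact hS i (by omega)

noncomputable def beta {V : Type*} (G : SimpleGraph V) (T : Finset V) : ℕ :=
  sSup {k | IsP G k T}

section
variable {V : Type*} [Fintype V] [DecidableEq V] {G G' : SimpleGraph V}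

lemma IsP.le_card {k : ℕ} {T : Finset V} (h : IsP G k T) : k + 1 ≤ Fintype.card V := by
  obtain ⟨f, hf, _⟩ := h
  exact hf.lt_card univ (by simp)

lemma bdd (T : Finset V) : BddAbove {k | IsP G k T} :=
  ⟨Fintype.card V, fun k hk => by have := IsP.le_card hk; omega⟩

lemma le_beta {k : ℕ} {T : Finset V} (h : IsP G k T) : k ≤ beta G T :=
  le_csSup (bdd T) h

lemma beta_mem {k : ℕ} {T : Finset V} (h : IsP G k T) : IsP G (beta G T) T :=
  Nat.sSup_mem ⟨k, h⟩ (bdd T)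

lemma isP_clique {t : ℕ} (ht : 1 ≤ t) {T : Finset V} (h : G.IsNClique t T) :
    IsP G (t - 1) T := by
  have hc := h.card_eq
  let e := T.equivFin
  let e' := (finCongr hc).symm.trans e.symm
  refine ⟨fun i => if h : i < t then (e' ⟨i, h⟩ : V) else (e' ⟨0, by omega⟩ : V), ⟨?_, ?_⟩, ?_⟩
  · intro i j hi hj h
    have h1 : i < t := by omega
    have h2 : j < t := by omega
    simp only [h1, h2, dite_true] at h
    have := e'.injective (Subtype.ext h)
    simpa using this
  · intro i hi
    have h1 : i < t := by omega
    have h2 : i + 1 < t := by omega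
    simp only [h1, h2, dite_true]
    apply h.isClique (e' _).2 (e' _).2
    intro h3
    have := e'.injective (Subtype.ext h3)
    simp at this
  · intro x hx
    refine ⟨(e'.symm ⟨x, hx⟩).val, by omega, ?_⟩
    simp

lemma le_beta_clique {t : ℕ} (ht : 1 ≤ t) {T : Finset V} (h : G.IsNClique t T) :
    t - 1 ≤ beta G T := le_beta (isP_clique ht h)

lemma beta_mono (hle : G' ≤ G) {k : ℕ} {T : Finset V} (h : IsP G' k T) :
    beta G' T ≤ beta G T := by
  obtain ⟨f, hf, hT⟩ := beta_mem h
  exact le_beta ⟨f, ⟨hf.1, fun i hi => hle (hf.2 i hi)⟩, hT⟩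

/-- longest path -/
def Longest (G : SimpleGraph V) (k : ℕ) : Prop := ∀ f, ¬ PathOn G (k + 1) f

lemma exists_longest (u v : V) (huv : G.Adj u v) :
    ∃ k f, 1 ≤ k ∧ PathOn G k f ∧ Longest G k := by
  have h1 : IsP G 1 ∅ := by
    refine ⟨fun i => if i = 0 then u else v, ⟨?_, ?_⟩, by simp⟩
    · intro i j hi hj h
      have := huv.ne
      have := huv.ne.symm
      interval_cases i <;> interval_cases j <;> simp_all
    · intro i hi
      interval_cases i
      simpa using huv
  obtain ⟨f, hf, _⟩ := beta_mem h1
  refine ⟨beta G ∅, f, le_beta h1, hf, ?_⟩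
  intro g hg
  have := le_beta (G := G) (T := ∅) ⟨g, hg, by simp⟩
  omega

lemma PathOn.rev {k : ℕ} {f : ℕ → V} (h : PathOn G k f) : PathOn G k (fun i => f (k - i)) := by
  refine ⟨?_, ?_⟩
  · intro i j hi hj hij
    have := h.1 _ _ (by omega) (by omega) hij
    omega
  · intro i hi
    have := h.2 (k - (i+1)) (by omega)
    rw [show k - (i+1) + 1 = k - i by omega] at this
    exact this.symm

lemma PathOn.cons {k : ℕ} {f : ℕ → V} (h : PathOn G k f) {x : V} (hx : ∀ i, i ≤ k → f i ≠ x)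
    (hadj : G.Adj x (f 0)) : PathOn G (k + 1) (fun i => if i = 0 then x else f (i - 1)) := by
  refine ⟨?_, ?_⟩
  · intro i j hi hj hij
    dsimp only at hij
    split_ifs at hij with h1 h2 h2
    · omega
    · exact absurd hij.symm (hx _ (by omega))
    · exact absurd hij (hx _ (by omega))
    · have := h.1 _ _ (by omega) (by omega) hij
      omega
  · intro i hi
    rcases Nat.eq_zero_or_pos i with rfl | hpos
    · simpa using hadj
    · have := h.2 (i-1) (by omega)
      rw [show i - 1 + 1 = i by omega] at this
      simpa [hpos.ne'] using this

lemma nbr_mem {k : ℕ} {f : ℕ → V} (h : PathOn G k f) (hL : Longest G k) {x : V}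
    (hx : G.Adj (f 0) x) : ∃ i, i < k ∧ f (i + 1) = x := by
  by_contra! hc
  refine hL _ (h.cons (x := x) ?_ hx.symm)
  intro i hi
  rcases Nat.eq_zero_or_pos i with rfl | hpos
  · exact hx.ne
  · have := hc (i-1) (by omega)
    rwa [show i - 1 + 1 = i by omega] at this

/-- rotating a cycle -/
lemma PathOn.rotate {k : ℕ} {f : ℕ → V} (h : PathOn G k f) (hc : G.Adj (f k) (f 0)) (j : ℕ) :
    PathOn G k (fun i => f ((j + i) % (k + 1))) := by
  refine ⟨?_, ?_⟩
  · intro a b ha hb hab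
    have h1 := Nat.mod_lt (j + a) (show 0 < k + 1 by omega)
    have h2 := Nat.mod_lt (j + b) (show 0 < k + 1 by omega)
    have h3 := h.1 _ _ (by omega) (by omega) hab
    have h4 : j + a ≡ j + b [MOD (k+1)] := h3
    have h5 := Nat.ModEq.add_left_cancel' j h4
    exact Nat.ModEq.eq_of_lt_of_lt h5 (by omega) (by omega)
  · intro i hi
    have h1 := Nat.mod_lt (j + i) (show 0 < k + 1 by omega)
    dsimp only
    rcases Nat.lt_or_ge ((j+i) % (k+1)) k with h2 | h2
    · have : (j + (i + 1)) % (k+1) = (j+i) % (k+1) + 1 := by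
        rw [← Nat.add_assoc, Nat.add_mod]
        rw [Nat.mod_eq_of_lt (show 1 < k + 1 by omega), Nat.mod_eq_of_lt (by omega)]
      rw [this]
      exact h.2 _ h2
    · have h3 : (j + i) % (k+1) = k := by omega
      have : (j + (i + 1)) % (k+1) = 0 := by
        rw [← Nat.add_assoc, Nat.add_mod, h3,
          Nat.mod_eq_of_lt (show 1 < k + 1 by omega), Nat.mod_self]
      rw [this, h3]
      exact hc

lemma no_cycle {k : ℕ} {f : ℕ → V} (h : PathOn G k f) (hL : Longest G k)
    (hc : G.Adj (f k) (f 0)) {j : ℕ} (hj : j ≤ k) {x : V} (hx : ∀ i, i ≤ k → f i ≠ x) :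
    ¬ G.Adj x (f j) := by
  intro hadj
  refine hL _ ((h.rotate hc j).cons (x := x) ?_ ?_)
  · intro i hi
    have h1 := Nat.mod_lt (j + i) (show 0 < k + 1 by omega)
    exact hx _ (by omega)
  · simpa [Nat.mod_eq_of_lt (show j < k + 1 by omega)] using hadj

lemma no_cross {k : ℕ} {f : ℕ → V} (h : PathOn G k f) (hL : Longest G k)
    {j : ℕ} (hj : j ≤ k) {x : V} (hx : ∀ i, i ≤ k → f i ≠ x) (hxj : G.Adj x (f j))
    {i : ℕ} (hi : i < k) (h0 : G.Adj (f 0) (f (i + 1))) (hk : G.Adj (f k) (f i)) : False := by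
  let c : ℕ → V := fun a => f (if a ≤ i then a else k + i + 1 - a)
  have hcP : PathOn G k c := by
    refine ⟨?_, ?_⟩
    · intro a b ha hb hab
      have := h.1 _ _ (by split_ifs <;> omega) (by split_ifs <;> omega) hab
      split_ifs at this <;> omega
    · intro a ha
      rcases lt_trichotomy a i with h1 | h1 | h1
      · simpa [c, h1.le, Nat.succ_le_of_lt h1] using h.2 a ha
      · subst h1
        have : k + a + 1 - (a + 1) = k := by omega
        simpa [c, this] using hk.symm
      · have e1 : ¬ a ≤ i := by omega
        have e2 : ¬ a + 1 ≤ i := by omega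
        simp only [c, e1, e2, if_false]
        have := h.2 (k + i + 1 - (a+1)) (by omega)
        rw [show k + i + 1 - (a+1) + 1 = k + i + 1 - a by omega] at this
        exact this.symm
  have hcc : G.Adj (c k) (c 0) := by
    have e1 : ¬ k ≤ i := by omega
    have e2 : k + i + 1 - k = i + 1 := by omega
    simpa [c, e1, e2] using h0.symm
  have : c (if j ≤ i then j else k + i + 1 - j) = f j := by
    simp only [c]
    congr 1
    split_ifs <;> omega
  refine no_cycle hcP hL hcc (j := if j ≤ i then j else k + i + 1 - j) (by split_ifs <;> omega)
    (x := x) ?_ (this ▸ hxj)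
  intro a ha
  exact hx _ (by split_ifs <;> omega)

open Classical in
noncomputable def nb (G : SimpleGraph V) (v : V) : Finset V := univ.filter (fun w => G.Adj v w)

@[simp] lemma mem_nb {v w : V} : w ∈ nb G v ↔ G.Adj v w := by simp [nb]

lemma nb_card_le {k : ℕ} {f : ℕ → V} (h : PathOn G k f) (hL : Longest G k) (A : Finset ℕ)
    (hA : ∀ i, i < k → G.Adj (f 0) (f (i+1)) → i ∈ A) : (nb G (f 0)).card ≤ A.card := by
  have : nb G (f 0) ⊆ A.image (fun i => f (i+1)) := by
    intro x hx
    rw [mem_nb] at hx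
    obtain ⟨i, hi, rfl⟩ := nbr_mem h hL hx
    exact mem_image_of_mem _ (hA i hi hx)
  exact (card_le_card this).trans card_image_le

lemma exists_low {k : ℕ} {f : ℕ → V} (h : PathOn G k f) (hL : Longest G k)
    {j : ℕ} (hj : j ≤ k) {x : V} (hx : ∀ i, i ≤ k → f i ≠ x) (hxj : G.Adj x (f j)) :
    ∃ g, PathOn G k g ∧ 2 * (nb G (g 0)).card ≤ k := by
  classical
  let A := (range k).filter (fun i => G.Adj (f 0) (f (i+1)))
  let B := (range k).filter (fun i => G.Adj (f k) (f i))
  have h1 : (nb G (f 0)).card ≤ A.card := nb_card_le h hL A (by intro i hi hh; simp [A, hi, hh])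
  have h2 : (nb G (f k)).card ≤ B.card := by
    have := nb_card_le h.rev hL (B.image (fun i => k - 1 - i)) (by
      intro i hi hh
      simp only [mem_image]
      refine ⟨k - (i+1), ?_, by omega⟩
      simp only [Nat.sub_zero] at hh
      simp only [B, mem_filter, mem_range]
      exact ⟨by omega, hh⟩)
    simp only [Nat.sub_zero] at this
    exact this.trans card_image_le
  have h3 : Disjoint A B := by
    rw [disjoint_left]
    intro i ha hb
    simp only [A, B, mem_filter, mem_range] at ha hb
    exact no_cross h hL hj hx hxj ha.1 ha.2 hb.2
  have h4 : A.card + B.card ≤ k := by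
    rw [← card_union_of_disjoint h3]
    calc _ ≤ (range k).card := card_le_card (by
          intro i hi; simp only [A, B, mem_union, mem_filter] at hi; tauto)
      _ = k := card_range k
  rcases Nat.lt_or_ge (nb G (f k)).card (nb G (f 0)).card with h5 | h5
  · exact ⟨_, h.rev, by simp only [Nat.sub_zero]; omega⟩
  · exact ⟨f, h, by omega⟩
end

lemma choose_half (a b s : ℕ) (h : 2 * a ≤ b) : 2 ^ s * a.choose s ≤ b.choose s := by
  have key : ∀ s, 2 ^ s * a.descFactorial s ≤ b.descFactorial s := by
    intro s
    induction s with
    | zero => simp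
    | succ s ih =>
      rw [Nat.descFactorial_succ, Nat.descFactorial_succ, pow_succ]
      calc 2 ^ s * 2 * ((a - s) * a.descFactorial s)
          = (2 * (a - s)) * (2 ^ s * a.descFactorial s) := by ring
        _ ≤ (b - s) * b.descFactorial s := Nat.mul_le_mul (by omega) ih
  have := key s
  rw [Nat.descFactorial_eq_factorial_mul_choose, Nat.descFactorial_eq_factorial_mul_choose] at this
  have hp := Nat.factorial_pos s
  have h2 : s.factorial * (2 ^ s * a.choose s) ≤ s.factorial * b.choose s := by
    linarith [this, mul_left_comm (s.factorial) (2^s) (a.choose s)]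
  exact Nat.le_of_mul_le_mul_left h2 hp

lemma num_strict (t d k : ℕ) (ht : 3 ≤ t) (hd : 2 * d ≤ k) (hd1 : 1 ≤ d) (hk : t - 1 ≤ k) :
    t * (t - 1) * d.choose (t - 1) < 2 * d * (k - 1).choose (t - 2) := by
  obtain ⟨s, rfl⟩ : ∃ s, t = s + 2 := ⟨t - 2, by omega⟩
  obtain ⟨a, rfl⟩ : ∃ a, d = a + 1 := ⟨d - 1, by omega⟩
  simp only [Nat.add_sub_cancel, show s + 2 - 1 = s + 1 by omega] at *
  have h1 := Nat.add_one_mul_choose_eq a s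
  have h2 := choose_half a (k - 1) s (by omega)
  have h3 : 0 < (k-1).choose s := Nat.choose_pos (by omega)
  have h4 : s + 2 < 2 * 2 ^ s := by
    clear h1 h2 h3
    have : 1 ≤ s := by omega
    clear ht hk
    induction s, this using Nat.le_induction with
    | base => norm_num
    | succ n hn ih => rw [pow_succ]; omega
  have h5 : (s + 2) * a.choose s < 2 * (k-1).choose s := by
    rcases Nat.eq_zero_or_pos (a.choose s) with h | h
    · rw [h]; omega
    · nlinarith
  calc (s + 2) * (s + 1) * (a+1).choose (s+1)
      = (s+2) * ((a+1).choose (s+1) * (s+1)) := by ring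
    _ = (a + 1) * ((s+2) * a.choose s) := by rw [← h1]; ring
    _ < (a+1) * (2 * (k-1).choose s) := Nat.mul_lt_mul_of_pos_left h5 (by omega)
    _ = _ := by ring

section
variable {V : Type*} [Fintype V] [DecidableEq V] {G G' : SimpleGraph V}

open Classical in
noncomputable def cl (G : SimpleGraph V) (t : ℕ) : Finset (Finset V) :=
  univ.filter (fun T => G.IsNClique t T)

open Classical in
noncomputable def ad (G : SimpleGraph V) : Finset (V × V) :=
  univ.filter (fun p => G.Adj p.1 p.2)

@[simp] lemma mem_cl {t : ℕ} {T : Finset V} : T ∈ cl G t ↔ G.IsNClique t T := by simp [cl]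
@[simp] lemma mem_ad {p : V × V} : p ∈ ad G ↔ G.Adj p.1 p.2 := by simp [ad]

noncomputable def wt (G : SimpleGraph V) (t : ℕ) (T : Finset V) : ℝ :=
  1 / ((beta G T - 1).choose (t - 2) : ℝ)

lemma double_count {t : ℕ} (F : Finset (Finset V)) (hF : F ⊆ cl G t) (w : Finset V → ℝ) :
    ((t : ℝ) * ((t : ℝ) - 1)) * ∑ T ∈ F, w T
      = ∑ p ∈ ad G, ∑ T ∈ F.filter (fun T => p.1 ∈ T ∧ p.2 ∈ T), w T := by
  have h1 : ∑ p ∈ ad G, ∑ T ∈ F.filter (fun T => p.1 ∈ T ∧ p.2 ∈ T), w T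
      = ∑ T ∈ F, ∑ p ∈ T.offDiag, w T := by
    apply sum_comm'
    rintro ⟨u, v⟩ T
    simp only [mem_ad, mem_filter, mem_offDiag]
    constructor
    · rintro ⟨h1, h2, h3, h4⟩
      exact ⟨⟨h3, h4, h1.ne⟩, h2⟩
    · rintro ⟨⟨h1, h2, h3⟩, h4⟩
      have := mem_cl.1 (hF h4)
      exact ⟨this.isClique h1 h2 h3, h4, h1, h2⟩
  rw [h1, mul_sum]
  apply sum_congr rfl
  intro T hT
  have hc := (mem_cl.1 (hF hT)).card_eq
  rw [sum_const, offDiag_card, hc, nsmul_eq_mul, Nat.cast_sub (Nat.le_mul_self t)]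
  push_cast
  ring

lemma wt_le {t k : ℕ} (ht : 3 ≤ t) {T : Finset V} (hk : t - 1 ≤ k) (h : IsP G k T) :
    wt G t T ≤ 1 / ((k - 1).choose (t - 2) : ℝ) := by
  have h1 := le_beta h
  unfold wt
  apply one_div_le_one_div_of_le
  · exact_mod_cast Nat.choose_pos (by omega)
  · exact_mod_cast Nat.choose_le_choose _ (by omega)

lemma wt_mono {t : ℕ} (ht : 3 ≤ t) (hle : G' ≤ G) {T : Finset V} (h : G'.IsNClique t T) :
    wt G t T ≤ wt G' t T := by
  have h0 := isP_clique (by omega) h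
  have h1 := beta_mono hle h0
  have h2 := le_beta h0
  unfold wt
  apply one_div_le_one_div_of_le
  · exact_mod_cast Nat.choose_pos (by omega)
  · exact_mod_cast Nat.choose_le_choose _ (by omega)

def del (G : SimpleGraph V) (D : Finset V) : SimpleGraph V where
  Adj u v := G.Adj u v ∧ u ∉ D ∧ v ∉ D
  symm := ⟨fun _ _ h => ⟨h.1.symm, h.2.2, h.2.1⟩⟩
  loopless := ⟨fun _ h => h.1.ne rfl⟩

lemma del_le (D : Finset V) : del G D ≤ G := fun _ _ h => h.1

lemma cl_del {t : ℕ} (ht : 3 ≤ t) (D : Finset V) :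
    (cl G t).filter (fun T => Disjoint T D) = cl (del G D) t := by
  ext T
  simp only [mem_filter, mem_cl]
  constructor
  · rintro ⟨h1, h2⟩
    refine ⟨?_, h1.card_eq⟩
    intro u hu v hv huv
    exact ⟨h1.isClique hu hv huv, disjoint_left.1 h2 hu, disjoint_left.1 h2 hv⟩
  · intro h
    refine ⟨⟨h.isClique.mono (del_le D), h.card_eq⟩, ?_⟩
    rw [disjoint_left]
    intro u hu
    obtain ⟨v, hv, hne⟩ := exists_mem_ne (show 1 < T.card by have := h.card_eq; omega) u
    exact (h.isClique hu hv hne.symm).2.1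

lemma ad_del (D : Finset V) :
    (ad G).card = (ad (del G D)).card + ((ad G).filter (fun p => p.1 ∈ D ∨ p.2 ∈ D)).card := by
  rw [← card_filter_add_card_filter_not (s := ad G) (fun p => p.1 ∈ D ∨ p.2 ∈ D), add_comm]
  congr 2
  ext p
  simp [del]

lemma sum_del {t : ℕ} (ht : 3 ≤ t) (D : Finset V) :
    ∑ T ∈ cl G t, wt G t T ≤ ∑ T ∈ cl (del G D) t, wt (del G D) t T
      + ∑ T ∈ (cl G t).filter (fun T => ¬ Disjoint T D), wt G t T := by
  rw [← sum_filter_add_sum_filter_not (cl G t) (fun T => Disjoint T D), cl_del ht]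
  gcongr with T hT
  exact wt_mono ht (del_le D) (mem_cl.1 hT)

lemma card_X {t : ℕ} (ht : 3 ≤ t) (S : Finset V) {u v : V} (hu : u ∈ S) (hv : v ∈ S)
    (huv : u ≠ v) :
    ((powersetCard t S).filter (fun T => u ∈ T ∧ v ∈ T)).card = (S.card - 2).choose (t - 2) := by
  have hc : ((S.erase u).erase v).card = S.card - 2 := by
    rw [card_erase_of_mem (by simp [huv.symm, hv]), card_erase_of_mem hu]; omega
  rw [← hc, ← card_powersetCard]
  refine card_bij' (fun T _ => (T.erase u).erase v) (fun R _ => insert u (insert v R)) ?_ ?_ ?_ ?_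
  · intro T hT
    simp only [mem_filter, mem_powersetCard] at hT ⊢
    refine ⟨erase_subset_erase _ (erase_subset_erase _ hT.1.1), ?_⟩
    rw [card_erase_of_mem (by simp [huv.symm, hT.2.2]), card_erase_of_mem hT.2.1]; omega
  · intro R hR
    simp only [mem_filter, mem_powersetCard] at hR ⊢
    have h1 : v ∉ R := fun h => by simpa using hR.1 h
    have h2 : u ∉ insert v R := fun h => by
      rcases mem_insert.1 h with h | h
      · exact huv h
      · simpa using hR.1 h
    refine ⟨⟨?_, ?_⟩, by simp⟩
    · intro x hx
      simp only [mem_insert] at hx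
      rcases hx with rfl | rfl | hx
      · exact hu
      · exact hv
      · exact mem_of_mem_erase (mem_of_mem_erase (hR.1 hx))
    · rw [card_insert_of_notMem h2, card_insert_of_notMem h1]; omega
  · intro T hT
    simp only [mem_filter, mem_powersetCard] at hT
    rw [insert_erase (by simp [huv.symm, hT.2.2]), insert_erase hT.2.1]
  · intro R hR
    simp only [mem_powersetCard] at hR
    have h1 : v ∉ R := fun h => by simpa using hR.1 h
    have h2 : u ∉ insert v R := fun h => by
      rcases mem_insert.1 h with h | h
      · exact huv h
      · simpa using hR.1 h
    rw [erase_insert h2, erase_insert h1]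

lemma caseA {t k : ℕ} (ht : 3 ≤ t) (hk : 1 ≤ k) {f : ℕ → V} (h : PathOn G k f)
    (S : Finset V) (hS : S = (range (k+1)).image f)
    (hcl : ∀ u v, G.Adj u v → u ∈ S → v ∈ S) :
    ((t : ℝ) * ((t : ℝ) - 1)) * ∑ T ∈ (cl G t).filter (fun T => ¬ Disjoint T S), wt G t T
      ≤ ((ad G).filter (fun p => p.1 ∈ S ∨ p.2 ∈ S)).card ∧
    (((t : ℝ) * ((t : ℝ) - 1)) * ∑ T ∈ (cl G t).filter (fun T => ¬ Disjoint T S), wt G t T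
      = ((ad G).filter (fun p => p.1 ∈ S ∨ p.2 ∈ S)).card →
      t ≤ S.card ∧ ∀ x ∈ S, ∀ y ∈ S, x ≠ y → G.Adj x y) := by
  have hmS : ∀ x, x ∈ S ↔ ∃ i, i ≤ k ∧ f i = x := by
    intro x; rw [hS]; simp [Nat.lt_succ_iff]
  have hSc : S.card = k + 1 := by
    rw [hS, card_image_of_injOn, card_range]
    intro a ha b hb hab
    simp at ha hb
    exact h.1 a b (by omega) (by omega) hab
  set F := (cl G t).filter (fun T => ¬ Disjoint T S) with hF
  have hFS : ∀ T ∈ F, G.IsNClique t T ∧ T ⊆ S := by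
    intro T hT
    simp only [hF, mem_filter, mem_cl, not_disjoint_iff] at hT
    obtain ⟨h1, u, hu, huS⟩ := hT
    refine ⟨h1, fun v hv => ?_⟩
    by_cases huv : u = v
    · rwa [← huv]
    · exact hcl u v (h1.isClique hu hv huv) huS
  have hwt : ∀ T ∈ F, t ≤ k + 1 ∧ wt G t T ≤ 1 / ((k - 1).choose (t - 2) : ℝ) := by
    intro T hT
    obtain ⟨h1, h2⟩ := hFS T hT
    have h3 : t ≤ k + 1 := by
      rw [← hSc, ← h1.card_eq]; exact card_le_card h2
    refine ⟨h3, wt_le ht (by omega) ⟨f, h, fun x hx => (hmS x).1 (h2 hx)⟩⟩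
  have key : ∀ p ∈ (ad G).filter (fun p => p.1 ∈ S ∨ p.2 ∈ S),
      ∑ T ∈ F.filter (fun T => p.1 ∈ T ∧ p.2 ∈ T), wt G t T ≤ 1 ∧
      (∑ T ∈ F.filter (fun T => p.1 ∈ T ∧ p.2 ∈ T), wt G t T = 1 →
        t ≤ k + 1 ∧ ∀ T ⊆ S, T.card = t → p.1 ∈ T → p.2 ∈ T → G.IsNClique t T) := by
    rintro ⟨u, v⟩ hp
    simp only [mem_filter, mem_ad] at hp
    obtain ⟨huv, hp⟩ := hp
    have hu : u ∈ S := hp.elim id (fun hv => hcl _ _ huv.symm hv)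
    have hv : v ∈ S := hcl _ _ huv hu
    simp only
    set X := (powersetCard t S).filter (fun T => u ∈ T ∧ v ∈ T) with hX
    have hXc : X.card = (k - 1).choose (t - 2) := by
      rw [hX, card_X ht S hu hv huv.ne, hSc]; congr 1
    set Fp := F.filter (fun T => u ∈ T ∧ v ∈ T) with hFp
    have hsub : Fp ⊆ X := by
      intro T hT
      simp only [hFp, hX, mem_filter, mem_powersetCard] at hT ⊢
      exact ⟨⟨(hFS T hT.1).2, (hFS T hT.1).1.card_eq⟩, hT.2⟩
    have hcard := card_le_card hsub
    by_cases htk : t ≤ k + 1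
    · have hpos : 0 < (k-1).choose (t-2) := Nat.choose_pos (by omega)
      have hposR : (0:ℝ) < ((k-1).choose (t-2) : ℝ) := by exact_mod_cast hpos
      have hle : ∑ T ∈ Fp, wt G t T ≤ Fp.card / ((k-1).choose (t-2) : ℝ) := by
        calc _ ≤ ∑ T ∈ Fp, 1 / ((k - 1).choose (t - 2) : ℝ) :=
              sum_le_sum (fun T hT => (hwt T (mem_filter.1 hT).1).2)
          _ = _ := by rw [sum_const, nsmul_eq_mul]; ring
      have hcR : (Fp.card : ℝ) ≤ ((k-1).choose (t-2) : ℝ) := by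
        rw [← hXc]; exact_mod_cast hcard
      refine ⟨hle.trans ((div_le_one hposR).2 hcR), fun heq => ⟨htk, ?_⟩⟩
      rw [heq, one_le_div hposR, ← hXc] at hle
      have : Fp = X := eq_of_subset_of_card_le hsub (by exact_mod_cast hle)
      intro T hTS hTc huT hvT
      have hTX : T ∈ X := by simp [hX, hTS, hTc, huT, hvT]
      rw [← this] at hTX
      exact (hFS T (mem_filter.1 hTX).1).1
    · have : Fp = ∅ := by
        rw [eq_empty_iff_forall_notMem]
        intro T hT
        exact htk (hwt T (mem_filter.1 hT).1).1
      rw [this]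
      simp
  have hdc := double_count F (filter_subset _ _) (wt G t)
  have hrest : ∑ p ∈ ad G, ∑ T ∈ F.filter (fun T => p.1 ∈ T ∧ p.2 ∈ T), wt G t T
      = ∑ p ∈ (ad G).filter (fun p => p.1 ∈ S ∨ p.2 ∈ S),
          ∑ T ∈ F.filter (fun T => p.1 ∈ T ∧ p.2 ∈ T), wt G t T := by
    symm
    apply sum_subset (filter_subset _ _)
    intro p hp hnp
    apply sum_eq_zero
    intro T hT
    exfalso
    apply hnp
    simp only [mem_filter] at hT ⊢
    exact ⟨hp, Or.inl ((hFS T hT.1).2 hT.2.1)⟩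
  rw [hdc, hrest]
  have hone : (((ad G).filter (fun p => p.1 ∈ S ∨ p.2 ∈ S)).card : ℝ)
      = ∑ p ∈ (ad G).filter (fun p => p.1 ∈ S ∨ p.2 ∈ S), (1:ℝ) := by simp
  rw [hone]
  refine ⟨sum_le_sum fun p hp => (key p hp).1, fun heq => ?_⟩
  rw [sum_eq_sum_iff_of_le (fun p hp => (key p hp).1)] at heq
  have hnb : ∀ x ∈ S, ∃ z ∈ S, G.Adj x z := by
    intro x hx
    obtain ⟨i, hi, rfl⟩ := (hmS x).1 hx
    have : ∃ z, G.Adj (f i) z := by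
      rcases Nat.lt_or_ge i k with h1 | h1
      · exact ⟨_, h.2 i h1⟩
      · have := h.2 (i-1) (by omega)
        rw [show i - 1 + 1 = i by omega] at this
        exact ⟨_, this.symm⟩
    obtain ⟨z, hz⟩ := this
    exact ⟨z, hcl _ _ hz hx, hz⟩
  have hall : ∀ x ∈ S, ∀ z ∈ S, G.Adj x z → t ≤ k + 1 ∧
      ∀ T ⊆ S, T.card = t → x ∈ T → z ∈ T → G.IsNClique t T := by
    intro x hx z hz hxz
    have hm : (x, z) ∈ (ad G).filter (fun p => p.1 ∈ S ∨ p.2 ∈ S) := by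
      simp [hxz, hx]
    exact (key _ hm).2 (heq _ hm)
  have htk : t ≤ k + 1 := by
    have h0 : f 0 ∈ S := (hmS _).2 ⟨0, by omega, rfl⟩
    obtain ⟨z, hz, hxz⟩ := hnb _ h0
    exact (hall _ h0 z hz hxz).1
  refine ⟨by omega, ?_⟩
  intro x hx y hy hxy
  obtain ⟨z, hz, hxz⟩ := hnb x hx
  obtain ⟨T, hT1, hT2, hT3⟩ := exists_subsuperset_card_eq (s := {x, y, z}) (t := S) (n := t)
    (by intro a ha; simp only [mem_insert, mem_singleton] at ha
        rcases ha with rfl | rfl | rfl <;> assumption)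
    (card_le_three.trans ht) (by omega)
  have := (hall x hx z hz hxz).2 T hT2 hT3 (hT1 (by simp)) (hT1 (by simp))
  exact this.isClique (hT1 (by simp)) (hT1 (by simp)) hxy

lemma caseB {t k : ℕ} (ht : 3 ≤ t) (hk : 1 ≤ k) {f : ℕ → V} (h : PathOn G k f)
    (hL : Longest G k) (hlow : 2 * (nb G (f 0)).card ≤ k) :
    ((t : ℝ) * ((t : ℝ) - 1)) * ∑ T ∈ (cl G t).filter (fun T => ¬ Disjoint T {f 0}), wt G t T
      < ((ad G).filter (fun p => p.1 ∈ ({f 0} : Finset V) ∨ p.2 ∈ ({f 0} : Finset V))).card := by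
  set v := f 0 with hv
  set d := (nb G v).card with hd
  have hd1 : 1 ≤ d := by
    rw [hd, Nat.succ_le_iff, card_pos]
    exact ⟨f 1, by simpa using h.2 0 (by omega)⟩
  have h2d : 2 * d ≤ ((ad G).filter (fun p => p.1 ∈ ({v} : Finset V) ∨ p.2 ∈ ({v} : Finset V))).card := by
    have hdis : Disjoint ((nb G v).image (fun w => (v, w))) ((nb G v).image (fun w => (w, v))) := by
      rw [disjoint_left]
      rintro ⟨a, b⟩ h1 h2
      simp only [mem_image, mem_nb, Prod.mk.injEq] at h1 h2
      obtain ⟨w, hw, rfl, rfl⟩ := h1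
      obtain ⟨w', hw', rfl, rfl⟩ := h2
      exact hw.ne rfl
    have hc : ((nb G v).image (fun w => (v, w)) ∪ (nb G v).image (fun w => (w, v))).card = 2 * d := by
      rw [card_union_of_disjoint hdis, card_image_of_injective _ (fun a b hab => by simpa using hab),
        card_image_of_injective _ (fun a b hab => by simpa using hab)]
      omega
    rw [← hc]
    apply card_le_card
    rintro ⟨a, b⟩ hab
    simp only [mem_union, mem_image, mem_nb, Prod.mk.injEq] at hab
    simp only [mem_filter, mem_ad, mem_singleton]
    rcases hab with ⟨w, hw, rfl, rfl⟩ | ⟨w, hw, rfl, rfl⟩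
    · exact ⟨hw, Or.inl rfl⟩
    · exact ⟨hw.symm, Or.inr rfl⟩
  have h2dR : (2 * (d:ℝ)) ≤ ((ad G).filter (fun p => p.1 ∈ ({v} : Finset V) ∨ p.2 ∈ ({v} : Finset V))).card := by
    exact_mod_cast h2d
  refine lt_of_lt_of_le ?_ h2dR
  set F := (cl G t).filter (fun T => ¬ Disjoint T {v}) with hF
  have hFm : ∀ T ∈ F, G.IsNClique t T ∧ v ∈ T := by
    intro T hT
    simpa [hF] using hT
  have hsub : ∀ T ∈ F, T.erase v ∈ powersetCard (t-1) (nb G v) := by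
    intro T hT
    obtain ⟨h1, h2⟩ := hFm T hT
    rw [mem_powersetCard, card_erase_of_mem h2, h1.card_eq]
    refine ⟨?_, rfl⟩
    intro x hx
    rw [mem_erase] at hx
    rw [mem_nb]
    exact h1.isClique h2 hx.2 hx.1.symm
  have hFc : F.card ≤ d.choose (t-1) := by
    rw [hd, ← card_powersetCard]
    apply card_le_card_of_injOn (fun T => T.erase v) (fun T hT => mem_coe.2 (hsub T (mem_coe.1 hT)))
    intro T hT T' hT' heq
    simp only at heq
    rw [← insert_erase (hFm T hT).2, heq, insert_erase (hFm T' hT').2]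
  have hd1R : (1:ℝ) ≤ d := by exact_mod_cast hd1
  by_cases htk : t - 1 ≤ k
  · have hns := num_strict t d k ht hlow hd1 htk
    have hpos : 0 < (k-1).choose (t-2) := Nat.choose_pos (by omega)
    have hposR : (0:ℝ) < ((k-1).choose (t-2) : ℝ) := by exact_mod_cast hpos
    have hle : ∑ T ∈ F, wt G t T ≤ d.choose (t-1) / ((k-1).choose (t-2) : ℝ) := by
      calc _ ≤ ∑ T ∈ F, 1 / ((k - 1).choose (t - 2) : ℝ) := by
            apply sum_le_sum
            intro T hT
            apply wt_le ht htk
            refine ⟨f, h, fun x hx => ?_⟩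
            obtain ⟨h1, h2⟩ := hFm T hT
            by_cases hxv : v = x
            · exact ⟨0, by omega, hxv⟩
            · obtain ⟨i, hi, he⟩ := nbr_mem h hL (h1.isClique h2 hx hxv)
              exact ⟨i+1, hi, he⟩
        _ = F.card / ((k-1).choose (t-2) : ℝ) := by rw [sum_const, nsmul_eq_mul]; ring
        _ ≤ _ := by gcongr
    have hnsR : (t:ℝ) * ((t:ℝ) - 1) * d.choose (t-1) < 2 * d * (k-1).choose (t-2) := by
      have : ((t - 1 : ℕ) : ℝ) = (t:ℝ) - 1 := by push_cast [show 1 ≤ t by omega]; ring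
      rw [← this]
      exact_mod_cast hns
    have htR : (0:ℝ) ≤ (t:ℝ) * ((t:ℝ) - 1) := by
      have : (3:ℝ) ≤ t := by exact_mod_cast ht
      nlinarith
    calc _ ≤ (t:ℝ) * ((t:ℝ) - 1) * (d.choose (t-1) / ((k-1).choose (t-2) : ℝ)) :=
          mul_le_mul_of_nonneg_left hle htR
      _ = ((t:ℝ) * ((t:ℝ) - 1) * d.choose (t-1)) / ((k-1).choose (t-2) : ℝ) := by ring
      _ < 2 * d := by rw [div_lt_iff₀ hposR]; exact hnsR
  · have : F = ∅ := by
      rw [← card_eq_zero]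
      have : d.choose (t-1) = 0 := Nat.choose_eq_zero_of_lt (by omega)
      omega
    rw [this]
    simp only [sum_empty, mul_zero]
    linarith

def Good (G : SimpleGraph V) (t : ℕ) : Prop :=
  (∀ u v w, G.Adj u v → G.Adj u w → v ≠ w → G.Adj v w) ∧
    ∀ v, 0 < (nb G v).card → t ≤ (nb G v).card + 1

lemma main_bound {t : ℕ} (ht : 3 ≤ t) : ∀ (M : ℕ) (G : SimpleGraph V), (ad G).card = M →
    ((t : ℝ) * ((t : ℝ) - 1)) * ∑ T ∈ cl G t, wt G t T ≤ (ad G).card ∧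
    (((t : ℝ) * ((t : ℝ) - 1)) * ∑ T ∈ cl G t, wt G t T = (ad G).card → Good G t) := by
  have htR : (0:ℝ) ≤ (t:ℝ) * ((t:ℝ) - 1) := by
    have : (3:ℝ) ≤ t := by exact_mod_cast ht
    nlinarith
  intro M
  induction M using Nat.strong_induction_on with
  | _ M ih =>
  intro G hM
  by_cases hE : ∃ u v, G.Adj u v
  · obtain ⟨u, v, huv⟩ := hE
    obtain ⟨k, f, hk, hf, hL⟩ := exists_longest u v huv
    have step : ∀ D : Finset V, f 0 ∈ D ∨ (∃ a ∈ D, ∃ b, G.Adj a b) →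
        (ad (del G D)).card < M := by
      intro D hD
      have : ∃ a ∈ D, ∃ b, G.Adj a b := by
        rcases hD with h | h
        · exact ⟨_, h, _, hf.2 0 (by omega)⟩
        · exact h
      obtain ⟨a, ha, b, hab⟩ := this
      have h1 := ad_del (G := G) D
      have h2 : 0 < ((ad G).filter (fun p => p.1 ∈ D ∨ p.2 ∈ D)).card :=
        card_pos.2 ⟨(a, b), by simp [ha, hab]⟩
      omega
    set S := (range (k+1)).image f with hS
    have hmS : ∀ x, x ∈ S ↔ ∃ i, i ≤ k ∧ f i = x := by
      intro x; rw [hS]; simp [Nat.lt_succ_iff]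
    have h0S : f 0 ∈ S := (hmS _).2 ⟨0, by omega, rfl⟩
    by_cases hcl : ∀ u v, G.Adj u v → u ∈ S → v ∈ S
    · obtain ⟨hA1, hA2⟩ := caseA ht hk hf S hS hcl
      obtain ⟨hI1, hI2⟩ := ih _ (step S (Or.inl h0S)) (del G S) rfl
      have hsum := mul_le_mul_of_nonneg_left (sum_del (G := G) ht S) htR
      rw [mul_add] at hsum
      have hadR : ((ad G).card : ℝ) = (ad (del G S)).card
          + ((ad G).filter (fun p => p.1 ∈ S ∨ p.2 ∈ S)).card := by
        exact_mod_cast ad_del S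
      refine ⟨by linarith, fun heq => ?_⟩
      obtain ⟨hg1, hg2⟩ := hI2 (by linarith)
      obtain ⟨hts, hadj⟩ := hA2 (by linarith)
      refine ⟨?_, ?_⟩
      · intro a b c hab hac hbc
        by_cases ha : a ∈ S
        · exact hadj _ (hcl _ _ hab ha) _ (hcl _ _ hac ha) hbc
        · have hb : b ∉ S := fun h => ha (hcl _ _ hab.symm h)
          have hc : c ∉ S := fun h => ha (hcl _ _ hac.symm h)
          exact (hg1 a b c ⟨hab, ha, hb⟩ ⟨hac, ha, hc⟩ hbc).1
      · intro a ha
        by_cases haS : a ∈ S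
        · have : S.erase a ⊆ nb G a := by
            intro x hx
            rw [mem_erase] at hx
            exact mem_nb.2 (hadj a haS x hx.2 hx.1.symm)
          have := card_le_card this
          rw [card_erase_of_mem haS] at this
          omega
        · have : nb (del G S) a = nb G a := by
            ext x
            simp only [mem_nb, del]
            refine ⟨fun h => h.1, fun h => ⟨h, haS, fun hx => haS (hcl _ _ h.symm hx)⟩⟩
          rw [← this] at ha ⊢
          exact hg2 a ha
    · push Not at hcl
      obtain ⟨a, x, hax, haS, hxS⟩ := hcl
      obtain ⟨j, hj, rfl⟩ := (hmS a).1 haS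
      obtain ⟨g, hg, hlow⟩ := exists_low hf hL hj (x := x)
        (fun i hi he => hxS ((hmS x).2 ⟨i, hi, he⟩)) hax.symm
      have hB := caseB ht hk hg hL hlow
      obtain ⟨hI1, -⟩ := ih _ (step {g 0} (Or.inr ⟨g 0, by simp, _, hg.2 0 (by omega)⟩))
        (del G {g 0}) rfl
      have hsum := mul_le_mul_of_nonneg_left (sum_del (G := G) ht {g 0}) htR
      rw [mul_add] at hsum
      have hadR : ((ad G).card : ℝ) = (ad (del G {g 0})).card
          + ((ad G).filter (fun p => p.1 ∈ ({g 0} : Finset V) ∨ p.2 ∈ ({g 0} : Finset V))).card := by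
        exact_mod_cast ad_del {g 0}
      exact ⟨by linarith, fun heq => by linarith⟩
  · push Not at hE
    have : cl G t = ∅ := by
      rw [eq_empty_iff_forall_notMem]
      intro T hT
      rw [mem_cl] at hT
      obtain ⟨a, ha, b, hb, hab⟩ := one_lt_card.1 (show 1 < T.card by have := hT.card_eq; omega)
      exact hE a b (hT.isClique ha hb hab)
    refine ⟨by rw [this]; simp, fun _ => ⟨fun u v w h => absurd h (hE u v), ?_⟩⟩
    intro v hv
    obtain ⟨w, hw⟩ := card_pos.1 hv
    exact absurd (mem_nb.1 hw) (hE v w)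

lemma good_beta {t : ℕ} (hg : Good G t) {k : ℕ} {f : ℕ → V} (h : PathOn G k f) {u : V}
    (hu : ∃ i, i ≤ k ∧ f i = u) : k ≤ (nb G u).card := by
  have hcl : ∀ x y, G.Adj x y → x ∈ insert u (nb G u) → y ∈ insert u (nb G u) := by
    intro x y hxy hx
    rw [mem_insert, mem_nb] at hx ⊢
    by_cases hyu : y = u
    · exact Or.inl hyu
    · right
      rcases hx with rfl | hx
      · exact hxy
      · exact hg.1 x u y hx.symm hxy (Ne.symm hyu)
  obtain ⟨i, hi, rfl⟩ := hu
  have hup : ∀ j, i + j ≤ k → f (i + j) ∈ insert (f i) (nb G (f i)) := by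
    intro j
    induction j with
    | zero => simp
    | succ j ihj => intro hj; exact hcl _ _ (h.2 (i+j) (by omega)) (ihj (by omega))
  have hdown : ∀ j, j ≤ i → f (i - j) ∈ insert (f i) (nb G (f i)) := by
    intro j
    induction j with
    | zero => simp
    | succ j ihj =>
      intro hj
      have := h.2 (i - (j+1)) (by omega)
      rw [show i - (j+1) + 1 = i - j by omega] at this
      exact hcl _ _ this.symm (ihj (by omega))
  have := h.lt_card (insert (f i) (nb G (f i))) (by
    intro j hj
    rcases le_total i j with h1 | h1
    · have := hup (j - i) (by omega)
      rwa [show i + (j - i) = j by omega] at this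
    · have := hdown (i - j) (by omega)
      rwa [show i - (i - j) = j by omega] at this)
  rw [card_insert_of_notMem (by simp)] at this
  omega

lemma good_ge {t : ℕ} (ht : 3 ≤ t) (hg : Good G t) :
    ((ad G).card : ℝ) ≤ ((t : ℝ) * ((t : ℝ) - 1)) * ∑ T ∈ cl G t, wt G t T := by
  rw [double_count (cl G t) subset_rfl (wt G t), card_eq_sum_ones]
  push_cast
  apply sum_le_sum
  rintro ⟨u, v⟩ huv
  rw [mem_ad] at huv
  simp only at huv ⊢
  set d := (nb G u).card with hd
  have hd0 : 0 < d := card_pos.2 ⟨v, mem_nb.2 huv⟩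
  have htd := hg.2 u hd0
  have hpos : 0 < (d-1).choose (t-2) := Nat.choose_pos (by omega)
  have hposR : (0:ℝ) < ((d-1).choose (t-2) : ℝ) := by exact_mod_cast hpos
  have hX := card_X ht (insert u (nb G u)) (u := u) (v := v) (by simp) (by simp [huv]) huv.ne
  rw [card_insert_of_notMem (by simp)] at hX
  rw [show (nb G u).card + 1 - 2 = d - 1 by omega] at hX
  have hsub : (powersetCard t (insert u (nb G u))).filter (fun T => u ∈ T ∧ v ∈ T) ⊆
      (cl G t).filter (fun T => u ∈ T ∧ v ∈ T) := by
    intro T hT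
    simp only [mem_filter, mem_powersetCard, mem_cl] at hT ⊢
    refine ⟨⟨?_, hT.1.2⟩, hT.2⟩
    intro x hx y hy hxy
    have hx' := hT.1.1 hx
    have hy' := hT.1.1 hy
    rw [mem_insert, mem_nb] at hx' hy'
    rcases hx' with rfl | hx' <;> rcases hy' with rfl | hy'
    · exact absurd rfl hxy
    · exact hy'
    · exact hx'.symm
    · exact hg.1 u x y hx' hy' hxy
  have hcard := card_le_card hsub
  rw [hX] at hcard
  calc (1:ℝ) = ((d-1).choose (t-2) : ℝ) * (1 / ((d-1).choose (t-2) : ℝ)) := by field_simp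
    _ ≤ ((cl G t).filter (fun T => u ∈ T ∧ v ∈ T)).card * (1 / ((d-1).choose (t-2) : ℝ)) := by
        gcongr
    _ = ∑ T ∈ (cl G t).filter (fun T => u ∈ T ∧ v ∈ T), (1 / ((d-1).choose (t-2) : ℝ)) := by
        rw [sum_const, nsmul_eq_mul]
    _ ≤ _ := by
        apply sum_le_sum
        intro T hT
        simp only [mem_filter, mem_cl] at hT
        have h0 := isP_clique (by omega) hT.1
        have h1 := le_beta h0
        obtain ⟨f, hf, hfT⟩ := beta_mem h0
        have h2 := good_beta hg hf (hfT u hT.2.1)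
        unfold wt
        apply one_div_le_one_div_of_le
        · exact_mod_cast Nat.choose_pos (by omega)
        · exact_mod_cast Nat.choose_le_choose _ (by omega)

lemma good_reach {t : ℕ} (hg : ∀ u v w, G.Adj u v → G.Adj u w → v ≠ w → G.Adj v w) {v w : V}
    (h : G.Reachable v w) : v ≠ w → G.Adj v w := by
  obtain ⟨p⟩ := h
  induction p with
  | nil => intro h; exact absurd rfl h
  | @cons a b c hab p ih =>
    intro hac
    by_cases hbc : b = c
    · exact hbc ▸ hab
    · exact hg b a c hab.symm (ih hbc) hac

lemma nb_card [DecidableRel G.Adj] (v : V) : (nb G v).card = G.degree v := by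
  rw [← SimpleGraph.card_neighborFinset_eq_degree]
  congr 1
  ext x
  simp

lemma good_iff {t : ℕ} [DecidableRel G.Adj] : Good G t ↔
    (∀ v w : V, G.Reachable v w → v ≠ w → G.Adj v w) ∧
        ∀ v : V, 0 < G.degree v → t ≤ Nat.card {w : V | G.Reachable v w} := by
  have key : (∀ v w : V, G.Reachable v w → v ≠ w → G.Adj v w) → ∀ v,
      Nat.card {w : V | G.Reachable v w} = (nb G v).card + 1 := by
    intro h v
    have : {w : V | G.Reachable v w} = ((insert v (nb G v) : Finset V) : Set V) := by
      ext w
      simp only [Set.mem_ofPred_eq, mem_coe, mem_insert, mem_nb]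
      constructor
      · intro hr
        by_cases hwv : w = v
        · exact Or.inl hwv
        · exact Or.inr (h v w hr (Ne.symm hwv))
      · rintro (rfl | h)
        · exact SimpleGraph.Reachable.refl _
        · exact h.reachable
    rw [this, Nat.card_coe_set_eq, Set.ncard_coe_finset, card_insert_of_notMem (by simp)]
  constructor
  · rintro ⟨h1, h2⟩
    have h3 : ∀ v w : V, G.Reachable v w → v ≠ w → G.Adj v w := fun v w h => good_reach (t := t) h1 h
    refine ⟨h3, fun v hv => ?_⟩
    rw [key h3 v]
    exact h2 v (by rwa [nb_card])
  · rintro ⟨h1, h2⟩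
    refine ⟨fun u v w huv huw hvw => h1 v w (huv.symm.reachable.trans huw.reachable) hvw,
      fun v hv => ?_⟩
    rw [← key h1 v]
    exact h2 v (by rwa [nb_card] at hv)

lemma ad_card [DecidableRel G.Adj] : (ad G).card = 2 * G.edgeFinset.card := by
  rw [← SimpleGraph.sum_degrees_eq_twice_card_edges]
  have : ad G = (univ.sigma (fun v => nb G v)).image (fun p => (p.1, p.2)) := by
    ext ⟨a, b⟩
    simp
  rw [this, card_image_of_injective, card_sigma]
  · exact sum_congr rfl (fun v _ => nb_card v)
  · rintro ⟨a, b⟩ ⟨c, d⟩ h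
    simpa using h
end

theorem stmt_7 {V : Type*} [Fintype V] [DecidableEq V]
    (G : SimpleGraph V) [DecidableRel G.Adj]
    (t m : ℕ) (ht : 3 ≤ t) (hm : G.edgeFinset.card = m)
    (β : Finset V → ℕ)
    (hβ : ∀ T : Finset V,
      β T = sSup {k : ℕ | ∃ S : G.Subgraph, ↑T ⊆ S.verts ∧
        Nonempty (S.coe ≃g SimpleGraph.pathGraph (k + 1))}) :
    (∀ T ∈ G.cliqueFinset t, t - 1 ≤ β T) ∧
    ∑ T ∈ G.cliqueFinset t, (1 : ℝ) / ((β T - 1).choose (t - 2) : ℝ) ≤ (m : ℝ) / (t.choose 2 : ℝ) ∧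
    (∑ T ∈ G.cliqueFinset t, (1 : ℝ) / ((β T - 1).choose (t - 2) : ℝ) = (m : ℝ) / (t.choose 2 : ℝ) ↔
      (∀ v w : V, G.Reachable v w → v ≠ w → G.Adj v w) ∧
        ∀ v : V, 0 < G.degree v → t ≤ Nat.card {w : V | G.Reachable v w}) := by
  have hb : ∀ T, β T = beta G T := by
    intro T
    rw [hβ, beta]
    congr 1
    ext k
    exact isP_iff G k T
  have hcl : G.cliqueFinset t = cl G t := by
    ext T
    rw [SimpleGraph.mem_cliqueFinset_iff, mem_cl]
  have hsum : ∑ T ∈ G.cliqueFinset t, (1 : ℝ) / ((β T - 1).choose (t - 2) : ℝ)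
      = ∑ T ∈ cl G t, wt G t T := by
    rw [hcl]
    exact sum_congr rfl (fun T _ => by rw [hb, wt])
  obtain ⟨h1, h2⟩ := main_bound ht _ G rfl
  have h3 := fun hg => good_ge (G := G) ht hg
  have hadR : ((ad G).card : ℝ) = 2 * m := by
    rw [ad_card, hm]; push_cast; ring
  have htR : (3:ℝ) ≤ t := by exact_mod_cast ht
  have hc2 : (t.choose 2 : ℝ) = t * ((t:ℝ) - 1) / 2 := Nat.cast_choose_two ℝ t
  have hpos : (0:ℝ) < t * ((t:ℝ) - 1) / 2 := by nlinarith
  rw [hadR] at h1 h2 h3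
  rw [hsum, hc2, le_div_iff₀ hpos, eq_div_iff hpos.ne', ← good_iff]
  refine ⟨?_, by linarith, ?_, ?_⟩
  · intro T hT
    rw [hb]
    exact le_beta_clique (by omega) (SimpleGraph.mem_cliqueFinset_iff.1 hT)
  · intro h
    exact h2 (by linarith)
  · intro h
    have := h3 h
    linarith
end

section
/- Let t ≥ q > i ≥ 1 be integers and let 𝓗 be a q-uniform hypergraph on n vertices. Suppose x assigns to each i-element vertex set I a real number x(I) ≥ q-1 satisfying d(I) = C(x(I) - i, q - i), where C denotes the generalized binomial coefficient. For each t-clique T of 𝓗 define x(T) = max{ x(I) : I an i-element subset of T } and s(T) = 1 / C(x(T) - i, t - i). Then x(T) ≥ t for every t-clique T (so s(T) is well-defined), and the sum of s(T) over all t-cliques T of 𝓗 is at most C(n, i) / C(t, i). -/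
/-- The generalized binomial coefficient `C(x, k) = x(x-1)⋯(x-k+1)/k!` for `x ≥ k-1`,
and `0` for `x < k-1`. -/
noncomputable def gchoose (x : ℝ) (k : ℕ) : ℝ :=
  if x < (k : ℝ) - 1 then 0 else (∏ i ∈ Finset.range k, (x - i)) / (Nat.factorial k)

noncomputable def PB (x : ℝ) (k : ℕ) : ℝ :=
  (∏ i ∈ Finset.range k, (x - i)) / (Nat.factorial k)

lemma PB_zero (x : ℝ) : PB x 0 = 1 := by simp [PB]

lemma PB_succ (x : ℝ) (k : ℕ) : (k + 1 : ℝ) * PB x (k + 1) = (x - k) * PB x k := by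
  unfold PB
  rw [Finset.prod_range_succ, Nat.factorial_succ]
  have h : (Nat.factorial k : ℝ) ≠ 0 := by positivity
  push_cast
  field_simp

lemma PB_succ_left (x : ℝ) (k : ℕ) : (k + 1 : ℝ) * PB x (k + 1) = x * PB (x - 1) k := by
  unfold PB
  rw [Finset.prod_range_succ', Nat.factorial_succ]
  have h : (Nat.factorial k : ℝ) ≠ 0 := by positivity
  have h2 : ∏ j ∈ Finset.range k, (x - ((j + 1 : ℕ) : ℝ)) = ∏ j ∈ Finset.range k, (x - 1 - j) := by
    apply Finset.prod_congr rfl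
    intro j _
    push_cast
    ring
  rw [h2]
  push_cast
  field_simp
  ring

lemma PB_self (k : ℕ) : PB k k = 1 := by
  induction k with
  | zero => simp [PB]
  | succ k ih =>
    have := PB_succ_left ((k + 1 : ℕ) : ℝ) k
    push_cast at this
    rw [show (k : ℝ) + 1 - 1 = k by ring, ih] at this
    have h : (k + 1 : ℝ) ≠ 0 := by positivity
    push_cast
    exact mul_left_cancel₀ h this

lemma PB_choose (m k : ℕ) (h : k ≤ m) : PB m k = (m.choose k : ℝ) := by
  induction k with
  | zero => simp [PB]
  | succ k ih =>
    have h1 := PB_succ (m : ℝ) k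
    rw [ih (by omega)] at h1
    have h2 := Nat.choose_succ_right_eq m k
    have h3 : ((m.choose (k+1) : ℝ)) * (k + 1) = m.choose k * ((m : ℝ) - k) := by
      rw [← Nat.cast_sub (by omega)]
      exact_mod_cast h2
    have h : (k + 1 : ℝ) ≠ 0 := by positivity
    apply mul_left_cancel₀ h
    linarith

lemma PB_nonneg (x : ℝ) (k : ℕ) (h : (k : ℝ) - 1 ≤ x) : 0 ≤ PB x k := by
  unfold PB
  apply div_nonneg _ (by positivity)
  apply Finset.prod_nonneg
  intro j hj
  have : (j : ℝ) + 1 ≤ k := by exact_mod_cast Finset.mem_range.1 hj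
  linarith

lemma PB_pos (x : ℝ) (k : ℕ) (h : (k : ℝ) ≤ x) : 0 < PB x k := by
  unfold PB
  apply div_pos _ (by positivity)
  apply Finset.prod_pos
  intro j hj
  have : (j : ℝ) + 1 ≤ k := by exact_mod_cast Finset.mem_range.1 hj
  linarith

lemma PB_mono (x y : ℝ) (k : ℕ) (h : (k : ℝ) - 1 ≤ x) (hxy : x ≤ y) : PB x k ≤ PB y k := by
  unfold PB
  apply div_le_div_of_nonneg_right _ (by positivity)
  apply Finset.prod_le_prod
  · intro j hj
    have : (j : ℝ) + 1 ≤ k := by exact_mod_cast Finset.mem_range.1 hj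
    linarith
  · intro j hj
    linarith

lemma PB_lt (x y : ℝ) (k : ℕ) (hk : 1 ≤ k) (h : (k : ℝ) - 1 ≤ x) (hxy : x < y) :
    PB x k < PB y k := by
  obtain ⟨k, rfl⟩ : ∃ l, k = l + 1 := ⟨k - 1, by omega⟩
  push_cast at h
  have h1 := PB_succ x k
  have h2 := PB_succ y k
  have h3 := PB_mono x y k (by linarith) hxy.le
  have h4 := PB_pos y k (by linarith)
  have h6 := PB_nonneg x k (by linarith)
  have h5 : (x - k) * PB x k < (y - k) * PB y k := by nlinarith
  rw [← h1, ← h2] at h5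
  exact lt_of_mul_lt_mul_left h5 (by positivity)

lemma gchoose_eq (x : ℝ) (k : ℕ) (h : (k : ℝ) - 1 ≤ x) : gchoose x k = PB x k := by
  unfold gchoose PB
  rw [if_neg (by linarith)]

lemma PB_cont (k : ℕ) : Continuous fun x => PB x k := by
  unfold PB
  fun_prop

lemma sum_deg {V : Type*} [Fintype V] [DecidableEq V] (K : Finset (Finset V)) (r : ℕ)
    (hK : ∀ S ∈ K, S.card = r) :
    ∑ v : V, ((K.filter fun S => v ∈ S).card : ℝ) = r * K.card := by
  have := Finset.sum_card_bipartiteAbove_eq_sum_card_bipartiteBelow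
    (s := (Finset.univ : Finset V)) (t := K) (fun v S => v ∈ S)
  simp only [Finset.bipartiteAbove, Finset.bipartiteBelow] at this
  have h2 : ∑ S ∈ K, (Finset.univ.filter fun v => v ∈ S).card = ∑ S ∈ K, r := by
    apply Finset.sum_congr rfl
    intro S hS
    rw [← hK S hS]
    congr 1
    ext; simp
  rw [h2, Finset.sum_const, smul_eq_mul] at this
  rw [mul_comm]
  exact_mod_cast this

lemma card_link {V : Type*} [DecidableEq V] (K : Finset (Finset V)) (I : Finset V) :
    ((K.filter fun S => I ⊆ S).image fun S => S \ I).card = (K.filter fun S => I ⊆ S).card := by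
  apply Finset.card_image_of_injOn
  intro S hS T hT h
  simp only [Finset.coe_filter, Set.mem_ofPred_eq] at hS hT
  simp only at h
  rw [← Finset.sdiff_union_of_subset hS.2, h, Finset.sdiff_union_of_subset hT.2]

/-- One step of Lovász's form of Kruskal-Katona, in Keevash's clique-counting form. -/
lemma clique_step {V : Type*} [Fintype V] [DecidableEq V] (k : ℕ) :
    ∀ (x : ℝ) (G K : Finset (Finset V)), (k : ℝ) + 1 ≤ x → (∀ e ∈ G, e.card = k + 1) →
      (G.card : ℝ) ≤ PB x (k + 1) → (∀ S ∈ K, S.card = k + 2) →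
      (∀ S ∈ K, ∀ e ⊆ S, e.card = k + 1 → e ∈ G) → (K.card : ℝ) ≤ PB x (k + 2) := by
  induction k using Nat.strong_induction_on with
  | _ k ih =>
  intro x G K hx hG hGc hK hKG
  have key : ∀ v : V, ((K.filter fun S => v ∈ S).card : ℝ) * (k + 1)
      ≤ (x - (k + 1)) * ((G.filter fun S => v ∈ S).card : ℝ) := by
    intro v
    rcases Nat.eq_zero_or_pos (G.filter fun S => v ∈ S).card with h0 | hpos
    · have : (K.filter fun S => v ∈ S).card = 0 := by
        rw [Finset.card_eq_zero, Finset.filter_eq_empty_iff] at h0 ⊢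
        intro S hS hv
        have hc := hK S hS
        obtain ⟨w, hw, hwv⟩ := Finset.exists_mem_ne (by omega : 1 < S.card) v
        refine h0 (hKG S hS (S.erase w) (Finset.erase_subset _ _) ?_) ?_
        · rw [Finset.card_erase_of_mem hw]; omega
        · exact Finset.mem_erase.2 ⟨hwv.symm, hv⟩
      rw [this, h0]; simp
    have b1 : (K.filter fun S => v ∈ S).card + (G.filter fun S => v ∈ S).card ≤ G.card := by
      rw [← Finset.card_filter_add_card_filter_not (s := G) (fun S => v ∈ S), add_comm]
      apply Nat.add_le_add_left
      apply Finset.card_le_card_of_injOn (fun S => S.erase v)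
      · intro S hS
        simp only [Finset.coe_filter, Set.mem_ofPred_eq] at hS ⊢
        refine ⟨hKG S hS.1 _ (Finset.erase_subset _ _) ?_, Finset.notMem_erase _ _⟩
        rw [Finset.card_erase_of_mem hS.2, hK S hS.1]; rfl
      · intro S hS T hT h
        simp only [Finset.coe_filter, Set.mem_ofPred_eq] at hS hT
        simp only at h
        rw [← Finset.insert_erase hS.2, h, Finset.insert_erase hT.2]
    have b1' : ((K.filter fun S => v ∈ S).card : ℝ) + (G.filter fun S => v ∈ S).card ≤ G.card := by
      exact_mod_cast b1
    have hp := PB_succ_left x k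
    rcases le_or_gt (PB (x - 1) k) ((G.filter fun S => v ∈ S).card : ℝ) with hle | hlt
    · have h1 : (G.card : ℝ) * (k + 1) ≤ x * (G.filter fun S => v ∈ S).card := by
        calc (G.card : ℝ) * (k + 1) ≤ PB x (k + 1) * (k + 1) := by gcongr
          _ = x * PB (x - 1) k := by linarith
          _ ≤ _ := by
            apply mul_le_mul_of_nonneg_left hle
            have : (0 : ℝ) ≤ k := by positivity
            linarith
      nlinarith
    · have hpos' : (1 : ℝ) ≤ ((G.filter fun S => v ∈ S).card : ℝ) := by exact_mod_cast hpos
      rcases Nat.eq_zero_or_pos k with rfl | hk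
      · rw [PB_zero] at hlt; linarith
      obtain ⟨l, rfl⟩ : ∃ l, k = l + 1 := ⟨k - 1, by omega⟩
      have hxl : ((l + 1 : ℕ) : ℝ) ≤ x - 1 := by linarith
      obtain ⟨z, ⟨hz1, hz2⟩, hz⟩ := intermediate_value_Icc hxl (PB_cont (l + 1)).continuousOn
        (show ((G.filter fun S => v ∈ S).card : ℝ) ∈ Set.Icc _ _ from
          ⟨by rw [PB_self]; exact hpos', hlt.le⟩)
      simp only at hz
      have e1 := card_link G {v}
      have e2 := card_link K {v}
      simp only [Finset.singleton_subset_iff] at e1 e2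
      have := ih l (by omega) z ((G.filter fun S => v ∈ S).image fun S => S \ {v})
        ((K.filter fun S => v ∈ S).image fun S => S \ {v}) (by push_cast at hz1; exact hz1)
        (by
          intro e he
          obtain ⟨S, hS, rfl⟩ := Finset.mem_image.1 he
          rw [Finset.mem_filter] at hS
          rw [Finset.sdiff_singleton_eq_erase, Finset.card_erase_of_mem hS.2, hG S hS.1]; rfl)
        (by rw [e1, hz])
        (by
          intro e he
          obtain ⟨S, hS, rfl⟩ := Finset.mem_image.1 he
          rw [Finset.mem_filter] at hS
          rw [Finset.sdiff_singleton_eq_erase, Finset.card_erase_of_mem hS.2, hK S hS.1]; rfl)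
        (by
          intro T hT e he hec
          obtain ⟨S, hS, rfl⟩ := Finset.mem_image.1 hT
          rw [Finset.mem_filter] at hS
          have hv : v ∉ e := fun h => by simpa using he h
          refine Finset.mem_image.2 ⟨insert v e, Finset.mem_filter.2 ⟨?_, by simp⟩, ?_⟩
          · apply hKG S hS.1
            · apply Finset.insert_subset hS.2
              exact he.trans Finset.sdiff_subset
            · rw [Finset.card_insert_of_notMem hv, hec]
          · rw [Finset.sdiff_singleton_eq_erase, Finset.erase_insert hv])
      rw [e2] at this
      have h3 := PB_succ z (l + 1)
      rw [hz] at h3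
      push_cast at h3 ⊢
      calc ((K.filter fun S => v ∈ S).card : ℝ) * (l + 1 + 1)
          ≤ PB z (l + 2) * (l + 1 + 1) := by gcongr
        _ = (z - (l + 1)) * ((G.filter fun S => v ∈ S).card : ℝ) := by linarith
        _ ≤ _ := mul_le_mul_of_nonneg_right (by linarith) (by positivity)
  have hs := Finset.sum_le_sum (s := Finset.univ) fun v _ => key v
  rw [← Finset.sum_mul, ← Finset.mul_sum, sum_deg K _ hK, sum_deg G _ hG] at hs
  have h4 := PB_succ x (k + 1)
  push_cast at hs h4
  have hk : (0 : ℝ) < k + 1 := by positivity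
  have h5 : (x - (k + 1)) * G.card ≤ (x - (k + 1)) * PB x (k + 1) :=
    mul_le_mul_of_nonneg_left hGc (by linarith)
  have h6 : ((k : ℝ) + 2) * K.card ≤ (x - (k + 1)) * G.card := by
    apply le_of_mul_le_mul_right _ hk
    linarith
  have h7 : ((k : ℝ) + 2) * K.card ≤ ((k : ℝ) + 2) * PB x (k + 2) := by
    have : (k : ℝ) + 1 + 1 = k + 2 := by ring
    rw [this] at h4
    rw [h4]; linarith
  exact le_of_mul_le_mul_left h7 (by positivity)

lemma clique_bound {V : Type*} [Fintype V] [DecidableEq V] (r : ℕ) (hr : 1 ≤ r) (x : ℝ)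
    (G : Finset (Finset V)) (hG : ∀ e ∈ G, e.card = r) (hGc : (G.card : ℝ) ≤ PB x r) (s : ℕ)
    (hs : r ≤ s) :
    ∀ K : Finset (Finset V), (s : ℝ) ≤ x → (∀ S ∈ K, S.card = s) →
      (∀ S ∈ K, ∀ e ⊆ S, e.card = r → e ∈ G) → (K.card : ℝ) ≤ PB x s := by
  induction s, hs using Nat.le_induction with
  | base =>
    intro K _ hK hKG
    refine le_trans ?_ hGc
    exact_mod_cast Finset.card_le_card fun S hS => hKG S hS S subset_rfl (hK S hS)
  | succ s hs ih =>
    intro K hx hK hKG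
    push_cast at hx
    obtain ⟨k, rfl⟩ : ∃ k, s = k + 1 := ⟨s - 1, by omega⟩
    push_cast at hx
    refine clique_step k x (Finset.univ.filter fun S => S.card = k + 1 ∧
      ∀ e ⊆ S, e.card = r → e ∈ G) K (by linarith) (by simp +contextual) ?_ hK ?_
    · apply ih
      · push_cast; linarith
      · simp +contextual
      · intro S hS
        exact (Finset.mem_filter.1 hS).2.2
    · intro S hS e he hec
      refine Finset.mem_filter.2 ⟨Finset.mem_univ _, hec, fun f hf => hKG S hS f (hf.trans he)⟩

theorem stmt_18 {V : Type*} [Fintype V] [DecidableEq V]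
    (q t i n : ℕ) (hi : 1 ≤ i) (hiq : i < q) (hqt : q ≤ t)
    (hn : Fintype.card V = n)
    -- the edge set of a `q`-uniform hypergraph `𝓗` on `V`
    (E : Finset (Finset V)) (hunif : ∀ e ∈ E, e.card = q)
    (x : Finset V → ℝ)
    (hx1 : ∀ I : Finset V, I.card = i → (q : ℝ) - 1 ≤ x I)
    -- `d(I) = C(x(I) - i, q - i)`
    (hx2 : ∀ I : Finset V, I.card = i →
      ((E.filter fun e => I ⊆ e).card : ℝ) = gchoose (x I - i) (q - i))
    (xT : Finset V → ℝ)
    (hxT : ∀ T : Finset V, xT T = sSup {y : ℝ | ∃ I ∈ T.powersetCard i, y = x I})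
    -- the set of `t`-cliques of `𝓗`
    (cliques : Finset (Finset V))
    (hcl : ∀ T : Finset V,
      T ∈ cliques ↔ T.card = t ∧ ∀ S ∈ T.powersetCard q, S ∈ E) :
    (∀ T ∈ cliques, (t : ℝ) ≤ xT T) ∧
    ∑ T ∈ cliques, 1 / gchoose (xT T - i) (t - i) ≤
      (n.choose i : ℝ) / (t.choose i : ℝ) := by
  have hcast : ((t - i : ℕ) : ℝ) = t - i := by rw [Nat.cast_sub (by omega)]
  have hcast2 : ((q - i : ℕ) : ℝ) = q - i := by rw [Nat.cast_sub (by omega)]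
  -- degrees as `PB`
  have hd : ∀ I : Finset V, I.card = i →
      ((E.filter fun e => I ⊆ e).card : ℝ) = PB (x I - i) (q - i) := by
    intro I hI
    rw [hx2 I hI, gchoose_eq]
    have := hx1 I hI
    linarith
  have hlink : ∀ I : Finset V, I.card = i → ∀ T ∈ cliques, I ⊆ T →
      ∀ e ⊆ T \ I, e.card = q - i → e ∈ (E.filter fun e => I ⊆ e).image fun e => e \ I := by
    intro I hI T hT hIT e he hec
    have hdis : Disjoint e I := Finset.disjoint_of_subset_left he Finset.sdiff_disjoint
    refine Finset.mem_image.2 ⟨e ∪ I, Finset.mem_filter.2 ⟨?_, Finset.subset_union_right⟩, ?_⟩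
    · apply ((hcl T).1 hT).2
      rw [Finset.mem_powersetCard]
      refine ⟨Finset.union_subset (he.trans Finset.sdiff_subset) hIT, ?_⟩
      rw [Finset.card_union_of_disjoint hdis, hec, hI]; omega
    · exact Finset.union_sdiff_cancel_right hdis
  have hcardT : ∀ I : Finset V, I.card = i → ∀ T ∈ cliques, I ⊆ T → (T \ I).card = t - i := by
    intro I hI T hT hIT
    rw [Finset.card_sdiff_of_subset hIT, ((hcl T).1 hT).1, hI]
  have hxt : ∀ I : Finset V, I.card = i → ∀ T ∈ cliques, I ⊆ T → (t : ℝ) ≤ x I := by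
    intro I hI T hT hIT
    by_contra hlt
    push Not at hlt
    have h1 : (t - i).choose (q - i) ≤ (E.filter fun e => I ⊆ e).card := by
      rw [← card_link, ← hcardT I hI T hT hIT, ← Finset.card_powersetCard]
      apply Finset.card_le_card
      intro e he
      rw [Finset.mem_powersetCard] at he
      exact hlink I hI T hT hIT e he.1 he.2
    have h2 : (((t - i).choose (q - i) : ℕ) : ℝ) ≤ PB (x I - i) (q - i) := by
      rw [← hd I hI]; exact_mod_cast h1
    rw [← PB_choose _ _ (by omega)] at h2
    have h3 := PB_lt (x I - i) ((t - i : ℕ) : ℝ) (q - i) (by omega)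
      (by have := hx1 I hI; linarith) (by linarith)
    linarith
  have hle : ∀ I : Finset V, I.card = i → ∀ T : Finset V, I ⊆ T → x I ≤ xT T := by
    intro I hI T hIT
    rw [hxT]
    apply le_csSup
    · apply Set.Finite.bddAbove
      have : {y : ℝ | ∃ I ∈ T.powersetCard i, y = x I} = Set.image x (T.powersetCard i : Set (Finset V)) := by
        ext y
        simp only [Set.mem_ofPred_eq, Set.mem_image, Finset.mem_coe, eq_comm]
      rw [this]
      exact (Finset.finite_toSet _).image _
    · exact ⟨I, Finset.mem_powersetCard.2 ⟨hIT, hI⟩, rfl⟩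
  have hfirst : ∀ T ∈ cliques, (t : ℝ) ≤ xT T := by
    intro T hT
    obtain ⟨I, hIT, hI⟩ := Finset.exists_subset_card_eq
      (show i ≤ T.card by rw [((hcl T).1 hT).1]; omega)
    exact (hxt I hI T hT hIT).trans (hle I hI T hIT)
  refine ⟨hfirst, ?_⟩
  have hI1 : ∀ I ∈ (Finset.univ : Finset V).powersetCard i,
      ∑ T ∈ cliques.filter (fun T => I ⊆ T), 1 / gchoose (xT T - i) (t - i) ≤ 1 := by
    intro I hI
    have hI := (Finset.mem_powersetCard.1 hI).2
    rcases (cliques.filter (fun T => I ⊆ T)).eq_empty_or_nonempty with h0 | ⟨T0, hT0⟩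
    · rw [h0]; simp
    rw [Finset.mem_filter] at hT0
    have hxI := hxt I hI T0 hT0.1 hT0.2
    have hpos := PB_pos (x I - i) (t - i) (by linarith)
    have hb := clique_bound (q - i) (by omega) (x I - i)
      ((E.filter fun e => I ⊆ e).image fun e => e \ I)
      (by
        intro e he
        obtain ⟨S, hS, rfl⟩ := Finset.mem_image.1 he
        rw [Finset.mem_filter] at hS
        rw [Finset.card_sdiff_of_subset hS.2, hunif S hS.1, hI])
      (by rw [card_link, hd I hI]) (t - i) (by omega)
      ((cliques.filter fun T => I ⊆ T).image fun T => T \ I) (by linarith)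
      (by
        intro S hS
        obtain ⟨T, hT, rfl⟩ := Finset.mem_image.1 hS
        rw [Finset.mem_filter] at hT
        exact hcardT I hI T hT.1 hT.2)
      (by
        intro S hS
        obtain ⟨T, hT, rfl⟩ := Finset.mem_image.1 hS
        rw [Finset.mem_filter] at hT
        exact hlink I hI T hT.1 hT.2)
    rw [card_link] at hb
    calc ∑ T ∈ cliques.filter (fun T => I ⊆ T), 1 / gchoose (xT T - i) (t - i)
        ≤ ∑ T ∈ cliques.filter (fun T => I ⊆ T), 1 / PB (x I - i) (t - i) := by
          apply Finset.sum_le_sum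
          intro T hT
          rw [Finset.mem_filter] at hT
          have h1 := hle I hI T hT.2
          rw [gchoose_eq _ _ (by linarith)]
          apply one_div_le_one_div_of_le hpos
          exact PB_mono _ _ _ (by linarith) (by linarith)
      _ = (cliques.filter (fun T => I ⊆ T)).card / PB (x I - i) (t - i) := by
          rw [Finset.sum_const, nsmul_eq_mul, mul_one_div]
      _ ≤ 1 := by rw [div_le_one hpos]; exact hb
  have hsum := Finset.sum_le_sum hI1
  rw [Finset.sum_const, Finset.card_powersetCard, Finset.card_univ, hn, nsmul_eq_mul, mul_one]
    at hsum
  have hswap : ∑ I ∈ (Finset.univ : Finset V).powersetCard i,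
      ∑ T ∈ cliques.filter (fun T => I ⊆ T), 1 / gchoose (xT T - i) (t - i)
      = (∑ T ∈ cliques, 1 / gchoose (xT T - i) (t - i)) * (t.choose i : ℝ) := by
    simp_rw [Finset.sum_filter]
    rw [Finset.sum_comm, Finset.sum_mul]
    apply Finset.sum_congr rfl
    intro T hT
    rw [← Finset.sum_filter, Finset.sum_const, nsmul_eq_mul, mul_comm]
    congr 2
    rw [← ((hcl T).1 hT).1, ← Finset.card_powersetCard]
    congr 1
    ext I
    simp only [Finset.mem_filter, Finset.mem_powersetCard, Finset.subset_univ, true_and]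
    tauto
  rw [hswap] at hsum
  rw [le_div_iff₀ (by exact_mod_cast Nat.choose_pos (by omega))]
  exact hsum
end
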